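/- arXiv:1912.07205 — 3 statements merged into one kernel-verified Lean document; each statement's English description precedes it below -/
import Mathlib

section
/- For every integer k ≥ 0, the 4-coloring complex B(Q_k') has exactly 2^k + 1 connected components. -/
/-- A proper 4-coloring of a simple graph `G`. -/
def IsProperColoring {V : Type*} (G : SimpleGraph V) (f : V → Fin 4) : Prop :=
  ∀ ⦃u v : V⦄, G.Adj u v → f u ≠ f v

/-- `kempeCount G f a b` is the number of `ab`-Kempe chains of `f`, i.e. the number of
connected components of the subgraph of `G` induced on `f⁻¹({a, b})`. -/
noncomputable def kempeCount {V : Type*} (G : SimpleGraph V) (f : V → Fin 4)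
    (a b : Fin 4) : ℕ :=
  Nat.card ((G.induce {v | f v = a ∨ f v = b}).ConnectedComponent)

/-- Tutte's quantity `J_a(f) = p(a,b) + p(a,c) + p(a,d) - p(b,c) - p(b,d) - p(c,d)`,
where `{b, c, d} = Fin 4 \ {a}`. -/
noncomputable def Jcol {V : Type*} (G : SimpleGraph V) (f : V → Fin 4) (a : Fin 4) : ℤ :=
  (∑ x ∈ Finset.univ.erase a, (kempeCount G f a x : ℤ)) -
    ∑ x ∈ Finset.univ.erase a,
      ∑ y ∈ (Finset.univ.erase a).filter (fun y => x < y), (kempeCount G f x y : ℤ)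

/-- The coloring-partition of `f`: the set of its nonempty color classes. -/
def colPart {V : Type*} (f : V → Fin 4) : Set (Set V) :=
  {A | A.Nonempty ∧ ∃ c, A = f ⁻¹' {c}}

/-- `P` is a coloring-partition of `G` if it is the coloring-partition of some proper
4-coloring of `G`. -/
def IsColoringPartition {V : Type*} (G : SimpleGraph V) (P : Set (Set V)) : Prop :=
  ∃ f, IsProperColoring G f ∧ P = colPart f

/-- The set of all color classes of proper 4-colorings of `G`. -/
def colorClasses {V : Type*} (G : SimpleGraph V) : Set (Set V) :=
  {A | A.Nonempty ∧ ∃ f c, IsProperColoring G f ∧ A = f ⁻¹' {c}}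

/-- The 4-coloring complex `B(G)`: vertices are color classes of proper 4-colorings of `G`,
two distinct classes being adjacent iff they are color classes of a common proper
4-coloring. -/
def colorComplex {V : Type*} (G : SimpleGraph V) : SimpleGraph (colorClasses G) :=
  SimpleGraph.fromRel (fun A B => ∃ f, IsProperColoring G f ∧
    (∃ c, (A : Set V) = f ⁻¹' {c}) ∧ (∃ c, (B : Set V) = f ⁻¹' {c}))

/-- Two proper 4-colorings are adjacent if they have a common (nonempty) color class. -/
def ColAdj {V : Type*} (G : SimpleGraph V) (f g : V → Fin 4) : Prop :=
  IsProperColoring G f ∧ IsProperColoring G g ∧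
    ∃ c c', (f ⁻¹' {c}).Nonempty ∧ f ⁻¹' {c} = g ⁻¹' {c'}

/-- Generating relation for `Q_k'`: like `Q_k`, but the outer chord is
`b_{k+1} d_{k+1}` instead of `a_{k+1} c_{k+1}`. -/
def qkRel' (k : ℕ) (u v : Fin (k + 2) × Fin 4) : Prop :=
  (u.1 = v.1 ∧ v.2 = u.2 + 1) ∨
  ((v.1 : ℕ) = (u.1 : ℕ) + 1 ∧ (v.2 = u.2 ∨ v.2 = u.2 + 1)) ∨
  ((u.1 : ℕ) = 0 ∧ (v.1 : ℕ) = 0 ∧ u.2 = 0 ∧ v.2 = 2) ∨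
  ((u.1 : ℕ) = k + 1 ∧ (v.1 : ℕ) = k + 1 ∧ u.2 = 1 ∧ v.2 = 3)

/-- The triangulation `Q_k'`. -/
def Qk' (k : ℕ) : SimpleGraph (Fin (k + 2) × Fin 4) := SimpleGraph.fromRel (qkRel' k)

namespace QkPrime

/-- The parity of a position on the 4-cycle; `true` means odd. -/
def parity (x : Fin 4) : Bool := decide (x.val % 2 = 1)

/-- The positions, layer by layer, of a color that starts at position `0` and
whose parities are prescribed by `p`. -/
def position (p : ℕ → Bool) : ℕ → Fin 4
  | 0 => 0
  | n + 1 => position p n + if p n = p (n + 1) then 2 else 3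

/-- Identify the two odd positions, coloring them `3` or `1` according to `b`. -/
def foldColor (b : Bool) (d : Fin 4) : Fin 4 :=
  if parity d then (if b then 3 else 1) else d

/-- The coloring with parities `p` in which each layer carries all four colors. -/
def rainbow (k : ℕ) (p : ℕ → Bool) (v : Fin (k + 2) × Fin 4) : Fin 4 :=
  v.2 - position p v.1

/-- The coloring with parities `p` in which each layer carries exactly three colors. -/
def striped (k : ℕ) (p : ℕ → Bool) (v : Fin (k + 2) × Fin 4) : Fin 4 :=
  foldColor (v.1 : ℕ).bodd (v.2 - position p v.1)

theorem position_succ_eq (p : ℕ → Bool) (n : ℕ) :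
    position p (n + 1) = position p n + 2 ∨ position p (n + 1) = position p n + 3 := by
  simp only [position]
  split <;> simp

theorem position_congr {p q : ℕ → Bool} {n : ℕ} (h : ∀ i ≤ n, p i = q i) :
    position p n = position q n := by
  induction n with
  | zero => rfl
  | succ n ih =>
    simp only [position]
    rw [ih fun i hi => h i (by omega), h n (by omega), h (n + 1) le_rfl]

theorem parity_add_two_or_three :
    ∀ (u : Fin 4) (b : Bool), parity (u + if parity u = b then 2 else 3) = b := by
  decide

theorem parity_position {p : ℕ → Bool} (hp : p 0 = false) (n : ℕ) :
    parity (position p n) = p n := by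
  induction n with
  | zero => rw [hp]; rfl
  | succ n ih =>
    simp only [position]
    rw [← ih]
    exact parity_add_two_or_three _ _

theorem parity_sub : ∀ a b : Fin 4, parity (a - b) = (parity a ^^ parity b) := by decide

theorem foldColor_eq_one : ∀ (b : Bool) (d : Fin 4),
    foldColor b d = 1 ↔ b = false ∧ parity d = true := by decide

theorem foldColor_eq_three : ∀ (b : Bool) (d : Fin 4),
    foldColor b d = 3 ↔ b = true ∧ parity d = true := by decide

theorem foldColor_eq_of_even : ∀ (c : Fin 4), parity c = false → ∀ (b : Bool) (d : Fin 4),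
    foldColor b d = c ↔ d = c := by decide

/-- Properness of a coloring of `Qk' k`, spelled out layer by layer. -/
theorem isProperColoring_iff {k : ℕ} {f : Fin (k + 2) × Fin 4 → Fin 4} :
    IsProperColoring (Qk' k) f ↔
      (∀ i j, f (i, j) ≠ f (i, j + 1)) ∧
      (∀ i i' : Fin (k + 2), (i' : ℕ) = i + 1 → ∀ j,
        f (i, j) ≠ f (i', j) ∧ f (i, j) ≠ f (i', j + 1)) ∧
      f (0, 0) ≠ f (0, 2) ∧ f (Fin.last (k + 1), 1) ≠ f (Fin.last (k + 1), 3) := by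
  constructor
  · intro h
    have key : ∀ u v, u ≠ v → qkRel' k u v → f u ≠ f v := fun u v huv hr =>
      h (by rw [Qk', SimpleGraph.fromRel_adj]; exact ⟨huv, Or.inl hr⟩)
    refine ⟨fun i j => key _ _ ?_ (Or.inl ⟨rfl, rfl⟩), fun i i' hi j => ⟨?_, ?_⟩, ?_, ?_⟩
    · simp
    · refine key _ _ ?_ (Or.inr (Or.inl ⟨hi, Or.inl rfl⟩))
      rintro ⟨⟩
      omega
    · refine key _ _ ?_ (Or.inr (Or.inl ⟨hi, Or.inr rfl⟩))
      intro he
      have := congrArg (fun v => (v.1 : ℕ)) he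
      simp only at this
      omega
    · exact key _ _ (by simp) (Or.inr (Or.inr (Or.inl ⟨rfl, rfl, rfl, rfl⟩)))
    · exact key _ _ (by simp) (Or.inr (Or.inr (Or.inr ⟨rfl, rfl, rfl, rfl⟩)))
  · rintro ⟨h1, h2, h3, h4⟩
    have key : ∀ u v, qkRel' k u v → f u ≠ f v := by
      rintro ⟨i, j⟩ ⟨i', j'⟩ (⟨hi, hj⟩ | ⟨hi, hj | hj⟩ | ⟨hi, hi', hj, hj'⟩ | ⟨hi, hi', hj, hj'⟩)
      · simp only at hi hj
        subst hi hj
        exact h1 _ _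
      · simp only at hi hj
        subst hj
        exact (h2 _ _ hi _).1
      · simp only at hi hj
        subst hj
        exact (h2 _ _ hi _).2
      · obtain rfl : i = 0 := Fin.ext hi
        obtain rfl : i' = 0 := Fin.ext hi'
        simp only at hj hj'
        rw [hj, hj']
        exact h3
      · obtain rfl : i = Fin.last (k + 1) := Fin.ext hi
        obtain rfl : i' = Fin.last (k + 1) := Fin.ext hi'
        simp only at hj hj'
        rw [hj, hj']
        exact h4
    intro u v huv
    rw [Qk', SimpleGraph.fromRel_adj] at huv
    rcases huv.2 with h | h
    · exact key _ _ h
    · exact (key _ _ h).symm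

theorem isProperColoring_rainbow (k : ℕ) (p : ℕ → Bool) :
    IsProperColoring (Qk' k) (rainbow k p) := by
  have ne_succ : ∀ j u : Fin 4, j - u ≠ j + 1 - u := by decide
  have ne_two : ∀ j u : Fin 4, j - u ≠ j - (u + 2) ∧ j - u ≠ j + 1 - (u + 2) := by decide
  have ne_three : ∀ j u : Fin 4, j - u ≠ j - (u + 3) ∧ j - u ≠ j + 1 - (u + 3) := by decide
  have ne_chord : ∀ u : Fin 4, 0 - u ≠ 2 - u ∧ 1 - u ≠ 3 - u := by decide
  refine isProperColoring_iff.2 ⟨fun i j => ne_succ _ _, fun i i' hi j => ?_,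
    (ne_chord _).1, (ne_chord _).2⟩
  simp only [rainbow, hi]
  rcases position_succ_eq p i with h | h <;> rw [h]
  · exact ne_two _ _
  · exact ne_three _ _

theorem isProperColoring_striped {k : ℕ} {p : ℕ → Bool} (hp : p 0 = false)
    (hpk : p (k + 1) = true) : IsProperColoring (Qk' k) (striped k p) := by
  have ne_succ : ∀ (b : Bool) (j u : Fin 4), foldColor b (j - u) ≠ foldColor b (j + 1 - u) := by
    decide
  have ne_two : ∀ (b : Bool) (j u : Fin 4),
      foldColor b (j - u) ≠ foldColor (!b) (j - (u + 2)) ∧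
      foldColor b (j - u) ≠ foldColor (!b) (j + 1 - (u + 2)) := by decide
  have ne_three : ∀ (b : Bool) (j u : Fin 4),
      foldColor b (j - u) ≠ foldColor (!b) (j - (u + 3)) ∧
      foldColor b (j - u) ≠ foldColor (!b) (j + 1 - (u + 3)) := by decide
  have ne_chord : ∀ (b : Bool) (u : Fin 4), parity u = true →
      foldColor b (1 - u) ≠ foldColor b (3 - u) := by decide
  refine isProperColoring_iff.2 ⟨fun i j => ne_succ _ _ _, fun i i' hi j => ?_, ?_, ?_⟩
  · simp only [striped, hi, Nat.bodd_succ]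
    rcases position_succ_eq p i with h | h <;> rw [h]
    · exact ne_two _ _ _
    · exact ne_three _ _ _
  · simp [striped, position, foldColor, parity]
  · exact ne_chord _ _ (by rw [← hpk]; exact parity_position hp _)

/-- A property of positions that propagates from each layer to the next holds along the
positions determined by some sequence of parities. -/
theorem exists_position {P : ℕ → Fin 4 → Prop} {N : ℕ} (h0 : P 0 0)
    (hs : ∀ n < N, ∀ u, P n u → P (n + 1) (u + 2) ∨ P (n + 1) (u + 3)) :
    ∃ p : ℕ → Bool, p 0 = false ∧ ∀ n ≤ N, P n (position p n) := by
  induction N with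
  | zero =>
    refine ⟨fun _ => false, rfl, fun n hn => ?_⟩
    obtain rfl : n = 0 := by omega
    exact h0
  | succ N ih =>
    obtain ⟨p, hp, h⟩ := ih fun n hn => hs n (by omega)
    obtain ⟨b, hb⟩ : ∃ b, P (N + 1) (position p N + if p N = b then 2 else 3) := by
      rcases hs N (by omega) _ (h N le_rfl) with h' | h'
      · exact ⟨p N, by simpa using h'⟩
      · exact ⟨!p N, by simpa using h'⟩
    have agree : ∀ i ≤ N, Function.update p (N + 1) b i = p i := fun i hi =>
      Function.update_of_ne (by omega) _ _
    refine ⟨Function.update p (N + 1) b, by rw [agree 0 (by omega), hp], fun n hn => ?_⟩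
    rcases Nat.lt_or_ge N n with hn' | hn'
    · obtain rfl : n = N + 1 := by omega
      simp only [position]
      rw [position_congr agree, agree N le_rfl, Function.update_self]
      exact hb
    · rw [position_congr fun i hi => agree i (by omega)]
      exact h n hn'

set_option synthInstance.maxSize 4000 in
set_option synthInstance.maxHeartbeats 200000 in
theorem rainbow_step_aux : ∀ u y₀ : Fin 4, y₀ ≠ 0 - u ∧ y₀ ≠ 3 - u →
    ∀ y₁ : Fin 4, y₀ ≠ y₁ ∧ y₁ ≠ 1 - u ∧ y₁ ≠ 0 - u →
    ∀ y₂ : Fin 4, y₁ ≠ y₂ ∧ y₂ ≠ 2 - u ∧ y₂ ≠ 1 - u →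
    ∀ y₃ : Fin 4, y₂ ≠ y₃ ∧ y₃ ≠ y₀ ∧ y₃ ≠ 3 - u ∧ y₃ ≠ 2 - u →
      (y₀ = 0 - (u + 2) ∧ y₁ = 1 - (u + 2) ∧ y₂ = 2 - (u + 2) ∧ y₃ = 3 - (u + 2)) ∨
      (y₀ = 0 - (u + 3) ∧ y₁ = 1 - (u + 3) ∧ y₂ = 2 - (u + 3) ∧ y₃ = 3 - (u + 3)) := by
  decide

set_option synthInstance.maxSize 4000 in
set_option synthInstance.maxHeartbeats 200000 in
theorem striped_step_aux : ∀ (b : Bool) (u y₀ : Fin 4),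
    y₀ ≠ foldColor b (0 - u) ∧ y₀ ≠ foldColor b (3 - u) →
    ∀ y₁ : Fin 4, y₀ ≠ y₁ ∧ y₁ ≠ foldColor b (1 - u) ∧ y₁ ≠ foldColor b (0 - u) →
    ∀ y₂ : Fin 4, y₁ ≠ y₂ ∧ y₂ ≠ foldColor b (2 - u) ∧ y₂ ≠ foldColor b (1 - u) →
    ∀ y₃ : Fin 4, y₂ ≠ y₃ ∧ y₃ ≠ y₀ ∧ y₃ ≠ foldColor b (3 - u) ∧ y₃ ≠ foldColor b (2 - u) →
      (y₀ = foldColor (!b) (0 - (u + 2)) ∧ y₁ = foldColor (!b) (1 - (u + 2)) ∧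
        y₂ = foldColor (!b) (2 - (u + 2)) ∧ y₃ = foldColor (!b) (3 - (u + 2))) ∨
      (y₀ = foldColor (!b) (0 - (u + 3)) ∧ y₁ = foldColor (!b) (1 - (u + 3)) ∧
        y₂ = foldColor (!b) (2 - (u + 3)) ∧ y₃ = foldColor (!b) (3 - (u + 3))) := by
  decide

theorem rainbow_step {u : Fin 4} {y : Fin 4 → Fin 4} (hy : ∀ j, y j ≠ y (j + 1))
    (h : ∀ j, j - u ≠ y j ∧ j - u ≠ y (j + 1)) :
    (∀ j, y j = j - (u + 2)) ∨ ∀ j, y j = j - (u + 3) := by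
  have := rainbow_step_aux u (y 0) ⟨(h 0).1.symm, (h 3).2.symm⟩
    (y 1) ⟨hy 0, (h 1).1.symm, (h 0).2.symm⟩ (y 2) ⟨hy 1, (h 2).1.symm, (h 1).2.symm⟩
    (y 3) ⟨hy 2, hy 3, (h 3).1.symm, (h 2).2.symm⟩
  simpa [Fin.forall_fin_succ] using this

theorem striped_step {b : Bool} {u : Fin 4} {y : Fin 4 → Fin 4} (hy : ∀ j, y j ≠ y (j + 1))
    (h : ∀ j, foldColor b (j - u) ≠ y j ∧ foldColor b (j - u) ≠ y (j + 1)) :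
    (∀ j, y j = foldColor (!b) (j - (u + 2))) ∨ ∀ j, y j = foldColor (!b) (j - (u + 3)) := by
  have := striped_step_aux b u (y 0) ⟨(h 0).1.symm, (h 3).2.symm⟩
    (y 1) ⟨hy 0, (h 1).1.symm, (h 0).2.symm⟩ (y 2) ⟨hy 1, (h 2).1.symm, (h 1).2.symm⟩
    (y 3) ⟨hy 2, hy 3, (h 3).1.symm, (h 2).2.symm⟩
  simpa [Fin.forall_fin_succ] using this

theorem exists_perm_eq {a b c d : Fin 4} (hab : a ≠ b) (hac : a ≠ c) (had : a ≠ d)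
    (hbc : b ≠ c) (hbd : b ≠ d) (hcd : c ≠ d) :
    ∃ σ : Equiv.Perm (Fin 4), ∀ j, σ j = ![a, b, c, d] j := by
  have inj : Function.Injective ![a, b, c, d] := by
    intro i j hij
    fin_cases i <;> fin_cases j <;> simp_all
  exact ⟨Equiv.ofBijective _ (Finite.injective_iff_bijective.1 inj), fun _ => rfl⟩

/-- Up to renaming colors, every proper coloring of `Qk' k` is rainbow or striped. -/
theorem exists_eq_rainbow_or_striped {k : ℕ} {f : Fin (k + 2) × Fin 4 → Fin 4}
    (hf : IsProperColoring (Qk' k) f) :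
    ∃ (p : ℕ → Bool) (σ : Equiv.Perm (Fin 4)), p 0 = false ∧
      (f = σ ∘ rainbow k p ∨ p (k + 1) = true ∧ f = σ ∘ striped k p) := by
  obtain ⟨h1, h2, h3, h4⟩ := isProperColoring_iff.1 hf
  have a1 : f (0, 0) ≠ f (0, 1) := h1 0 0
  have a2 : f (0, 1) ≠ f (0, 2) := h1 0 1
  have a3 : f (0, 2) ≠ f (0, 3) := h1 0 2
  have a4 : f (0, 3) ≠ f (0, 0) := h1 0 3
  have layers : ∀ (σ : Equiv.Perm (Fin 4)) (n) (hn : n + 1 < k + 2) (j : Fin 4),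
      σ.symm (f (⟨n + 1, hn⟩, j)) ≠ σ.symm (f (⟨n + 1, hn⟩, j + 1)) := fun σ n hn j =>
    σ.symm.injective.ne (h1 _ _)
  by_cases h13 : f (0, 1) = f (0, 3)
  · obtain ⟨e, he0, he1, he2⟩ : ∃ e, e ≠ f (0, 0) ∧ e ≠ f (0, 1) ∧ e ≠ f (0, 2) := by
      generalize f (0, 0) = a, f (0, 1) = b, f (0, 2) = c
      revert a b c
      decide
    obtain ⟨σ, hσ⟩ := exists_perm_eq a1 h3 he0.symm a2 he1.symm he2.symm
    obtain ⟨p, hp, h⟩ := exists_position (N := k + 1)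
      (P := fun n u => ∀ h : n < k + 2, ∀ j, f (⟨n, h⟩, j) = σ (foldColor n.bodd (j - u)))
      (by
        intro _ j
        fin_cases j <;> simp [hσ, foldColor, parity, h13])
      (by
        intro n hn u hu
        have hu' := hu (by omega)
        have s := h2 ⟨n, by omega⟩ ⟨n + 1, by omega⟩ rfl
        have := striped_step (b := n.bodd) (u := u) (layers σ n (by omega)) fun j => by
          have := s j
          rw [hu'] at this
          exact ⟨fun h => this.1 (by rw [h, σ.apply_symm_apply]),
            fun h => this.2 (by rw [h, σ.apply_symm_apply])⟩
        simp only [σ.symm_apply_eq] at this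
        simp only [Nat.bodd_succ]
        exact this.imp (fun h _ => h) (fun h _ => h))
    refine ⟨p, σ, hp, Or.inr ⟨?_, funext fun v => h v.1 (by omega) v.1.2 v.2⟩⟩
    rw [← parity_position hp]
    by_contra hpar
    have even_fold : ∀ (b : Bool) (u : Fin 4), parity u ≠ true →
        foldColor b (1 - u) = foldColor b (3 - u) := by decide
    have hl := h (k + 1) le_rfl (by omega)
    exact h4 (by rw [Fin.last, hl, hl, even_fold _ _ hpar])
  · obtain ⟨σ, hσ⟩ := exists_perm_eq a1 h3 a4.symm a2 h13 a3
    obtain ⟨p, hp, h⟩ := exists_position (N := k + 1)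
      (P := fun n u => ∀ h : n < k + 2, ∀ j, f (⟨n, h⟩, j) = σ (j - u))
      (by
        intro _ j
        fin_cases j <;> simp [hσ])
      (by
        intro n hn u hu
        have hu' := hu (by omega)
        have s := h2 ⟨n, by omega⟩ ⟨n + 1, by omega⟩ rfl
        have := rainbow_step (u := u) (layers σ n (by omega)) fun j => by
          have := s j
          rw [hu'] at this
          exact ⟨fun h => this.1 (by rw [h, σ.apply_symm_apply]),
            fun h => this.2 (by rw [h, σ.apply_symm_apply])⟩
        simp only [σ.symm_apply_eq] at this
        exact this.imp (fun h _ => h) (fun h _ => h))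
    exact ⟨p, σ, hp, Or.inl (funext fun v => h v.1 (by omega) v.1.2 v.2)⟩

theorem parity_of_rainbow_eq {k : ℕ} {p : ℕ → Bool} (hp : p 0 = false) {c : Fin 4}
    {v : Fin (k + 2) × Fin 4} (h : rainbow k p v = c) : parity v.2 = (parity c ^^ p v.1) := by
  rw [← h, rainbow, parity_sub, parity_position hp]
  simp

/-- A common color class of two rainbow colorings determines the parities. -/
theorem eq_of_rainbow_preimage_eq {k : ℕ} {p q : ℕ → Bool} (hp : p 0 = false) (hq : q 0 = false)
    {c d : Fin 4} (h : rainbow k p ⁻¹' {c} = rainbow k q ⁻¹' {d}) {n : ℕ} (hn : n < k + 2) :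
    p n = q n := by
  have key : ∀ n < k + 2, (parity c ^^ p n) = (parity d ^^ q n) := by
    intro n hn
    have hc : rainbow k p (⟨n, hn⟩, c + position p n) = c := by simp [rainbow]
    have hd : rainbow k q (⟨n, hn⟩, c + position p n) = d :=
      h.subset (show _ ∈ rainbow k p ⁻¹' {c} from hc)
    exact (parity_of_rainbow_eq hp hc).symm.trans (parity_of_rainbow_eq hq hd)
  have h0 := key 0 (by omega)
  have hn := key n hn
  rw [hp, hq] at h0
  rw [Bool.xor_false, Bool.xor_false] at h0
  rwa [h0, Bool.xor_right_inj] at hn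

/-- A color class of a striped coloring is not one of an even rainbow coloring. -/
theorem striped_preimage_ne_rainbow_preimage {k : ℕ} {p q : ℕ → Bool} (hp : p 0 = false)
    (hpk : p (k + 1) = true) (hq : q 0 = false) (hqk : q (k + 1) = false) (c d : Fin 4) :
    striped k p ⁻¹' {c} ≠ rainbow k q ⁻¹' {d} := by
  intro h
  have mem : ∀ v, striped k p v = c → rainbow k q v = d := fun v hv => h.subset hv
  have two : ∀ (i : Fin (k + 2)) (j : Fin 4), striped k p (i, j) = c →
      striped k p (i, j + 2) = c → False := by
    intro i j h1 h2
    have h1 := mem _ h1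
    have h2 := mem _ h2
    rw [← h2] at h1
    have : ∀ j u : Fin 4, j - u ≠ j + 2 - u := by decide
    exact this _ _ h1
  have odd_shift : ∀ u : Fin 4, parity (u + 1 - u) = true ∧ parity (u + 1 + 2 - u) = true := by
    decide
  rcases hc : parity c with _ | _
  · have hv : ∀ (n : ℕ) (hn : n < k + 2), striped k p (⟨n, hn⟩, c + position p n) = c := by
      intro n hn
      rw [striped, foldColor_eq_of_even c hc]
      simp
    have h0 := parity_of_rainbow_eq hq (mem _ (hv 0 (by omega)))
    have h1 := parity_of_rainbow_eq hq (mem _ (hv (k + 1) (by omega)))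
    have parity_add : ∀ a b : Fin 4, parity (a + b) = (parity a ^^ parity b) := by decide
    simp only [parity_add, parity_position hp, hp, hq, hpk, hqk, hc] at h0 h1
    simp [← h0] at h1
  · have odd_eq : ∀ c : Fin 4, parity c = true → c = 1 ∨ c = 3 := by decide
    rcases odd_eq c hc with rfl | rfl
    · refine two 0 (position p 0 + 1) ?_ ?_ <;>
        simp only [striped, foldColor_eq_one] <;>
        simp [(odd_shift _).2, show parity 1 = true from rfl]
    · refine two 1 (position p 1 + 1) ?_ ?_ <;>
        simp only [striped, foldColor_eq_three] <;>
        simp [(odd_shift _).2, show parity 1 = true from rfl]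

theorem rainbow_congr {k : ℕ} {p q : ℕ → Bool} (h : ∀ n < k + 2, p n = q n) :
    rainbow k p = rainbow k q := by
  funext v
  rw [rainbow, rainbow, position_congr fun i hi => h i (by omega)]

theorem striped_preimage_one_congr {k : ℕ} {p q : ℕ → Bool} (hp : p 0 = false) (hq : q 0 = false)
    (h : ∀ n < k + 2, n.bodd = false → p n = q n) :
    striped k p ⁻¹' {1} = striped k q ⁻¹' {1} := by
  ext v
  simp only [Set.mem_preimage, Set.mem_singleton_iff, striped, foldColor_eq_one, parity_sub,
    parity_position hp, parity_position hq]
  exact and_congr_right fun hv => by rw [h _ v.1.2 hv]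

theorem striped_preimage_three_congr {k : ℕ} {p q : ℕ → Bool} (hp : p 0 = false)
    (hq : q 0 = false) (h : ∀ n < k + 2, n.bodd = true → p n = q n) :
    striped k p ⁻¹' {3} = striped k q ⁻¹' {3} := by
  ext v
  simp only [Set.mem_preimage, Set.mem_singleton_iff, striped, foldColor_eq_three, parity_sub,
    parity_position hp, parity_position hq]
  exact and_congr_right fun hv => by rw [h _ v.1.2 hv]

theorem striped_preimage_zero (k : ℕ) (p : ℕ → Bool) :
    striped k p ⁻¹' {0} = rainbow k p ⁻¹' {0} := by
  ext v
  exact foldColor_eq_of_even 0 rfl _ _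

theorem nonempty_striped_preimage (k : ℕ) (p : ℕ → Bool) (c : Fin 4) :
    (striped k p ⁻¹' {c}).Nonempty := by
  have h : ∀ c u v : Fin 4, (∃ j, foldColor false (j - u) = c) ∨
      ∃ j, foldColor true (j - v) = c := by decide
  rcases h c (position p 0) (position p 1) with ⟨j, hj⟩ | ⟨j, hj⟩
  · exact ⟨(0, j), by simpa [striped] using hj⟩
  · exact ⟨(1, j), by simpa [striped] using hj⟩

theorem nonempty_rainbow_preimage (k : ℕ) (p : ℕ → Bool) (c : Fin 4) :
    (rainbow k p ⁻¹' {c}).Nonempty :=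
  ⟨(0, c + position p 0), by simp [rainbow]⟩

/-- A color class of a rainbow coloring as a vertex of the coloring complex. -/
def rainbowClass (k : ℕ) (p : ℕ → Bool) (c : Fin 4) : colorClasses (Qk' k) :=
  ⟨rainbow k p ⁻¹' {c}, nonempty_rainbow_preimage k p c, _, c, isProperColoring_rainbow k p, rfl⟩

theorem reachable_of_common {V : Type*} {G : SimpleGraph V} {f : V → Fin 4}
    (hf : IsProperColoring G f) {A B : colorClasses G} {c d : Fin 4}
    (hA : (A : Set V) = f ⁻¹' {c}) (hB : (B : Set V) = f ⁻¹' {d}) :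
    (colorComplex G).Reachable A B := by
  by_cases h : A = B
  · rw [h]
  · refine SimpleGraph.Adj.reachable ?_
    rw [colorComplex, SimpleGraph.fromRel_adj]
    exact ⟨h, Or.inl ⟨f, hf, ⟨c, hA⟩, ⟨d, hB⟩⟩⟩

theorem preimage_perm_comp {V : Type*} (σ : Equiv.Perm (Fin 4)) (f : V → Fin 4) (c : Fin 4) :
    (σ ∘ f) ⁻¹' {c} = f ⁻¹' {σ.symm c} := by
  ext v
  simp [Equiv.eq_symm_apply]

/-- The classes of an even rainbow coloring are adjacent only to each other. -/
theorem exists_eq_of_reachable {k : ℕ} {p : ℕ → Bool} (hp : p 0 = false)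
    (hpk : p (k + 1) = false) {A B : colorClasses (Qk' k)}
    (hAB : (colorComplex (Qk' k)).Reachable A B)
    (hA : ∃ c, (A : Set (Fin (k + 2) × Fin 4)) = rainbow k p ⁻¹' {c}) :
    ∃ d, (B : Set (Fin (k + 2) × Fin 4)) = rainbow k p ⁻¹' {d} := by
  have step : ∀ (A B : colorClasses (Qk' k)) (f : _ → Fin 4), IsProperColoring (Qk' k) f →
      (∃ c, (A : Set (Fin (k + 2) × Fin 4)) = f ⁻¹' {c}) →
      (∃ c, (B : Set (Fin (k + 2) × Fin 4)) = f ⁻¹' {c}) →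
      (∃ c, (A : Set (Fin (k + 2) × Fin 4)) = rainbow k p ⁻¹' {c}) →
      ∃ d, (B : Set (Fin (k + 2) × Fin 4)) = rainbow k p ⁻¹' {d} := by
    rintro A B f hf ⟨a, ha⟩ ⟨b, hb⟩ ⟨c, hc⟩
    rw [ha] at hc
    obtain ⟨q, σ, hq, rfl | ⟨hqk, rfl⟩⟩ := exists_eq_rainbow_or_striped hf
    · rw [preimage_perm_comp] at hc hb
      exact ⟨_, by rw [hb, rainbow_congr fun n => eq_of_rainbow_preimage_eq hq hp hc]⟩
    · rw [preimage_perm_comp] at hc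
      exact (striped_preimage_ne_rainbow_preimage hq hqk hp hpk _ _ hc).elim
  obtain ⟨w⟩ := hAB
  induction w with
  | nil => exact hA
  | cons h _ ih =>
    rw [colorComplex, SimpleGraph.fromRel_adj] at h
    rcases h.2 with ⟨f, hf, hA', hB'⟩ | ⟨f, hf, hB', hA'⟩ <;> exact ih (step _ _ f hf hA' hB' hA)

/-- All classes of odd rainbow colorings are in the same component. -/
theorem reachable_rainbowClass_of_odd {k : ℕ} {p q : ℕ → Bool} (hp : p 0 = false)
    (hpk : p (k + 1) = true) (hq : q 0 = false) (hqk : q (k + 1) = true) :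
    (colorComplex (Qk' k)).Reachable (rainbowClass k p 0) (rainbowClass k q 0) := by
  let m : ℕ → Bool := fun n => if n.bodd then q n else p n
  have hm : m 0 = false := by simp [m, hp]
  have hmk : m (k + 1) = true := by simp [m, hpk, hqk]
  let e : colorClasses (Qk' k) := ⟨striped k m ⁻¹' {1}, nonempty_striped_preimage k m 1, _, 1,
    isProperColoring_striped hm hmk, rfl⟩
  let o : colorClasses (Qk' k) := ⟨striped k m ⁻¹' {3}, nonempty_striped_preimage k m 3, _, 3,
    isProperColoring_striped hm hmk, rfl⟩
  have h1 : (colorComplex (Qk' k)).Reachable (rainbowClass k p 0) e :=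
    reachable_of_common (isProperColoring_striped hp hpk) (striped_preimage_zero k p).symm
      (striped_preimage_one_congr hm hp fun n _ hn => by simp [m, hn])
  have h2 : (colorComplex (Qk' k)).Reachable e o :=
    reachable_of_common (isProperColoring_striped hm hmk) rfl rfl
  have h3 : (colorComplex (Qk' k)).Reachable o (rainbowClass k q 0) :=
    reachable_of_common (isProperColoring_striped hq hqk)
      (striped_preimage_three_congr hm hq fun n _ hn => by simp [m, hn])
      (striped_preimage_zero k q).symm
  exact (h1.trans h2).trans h3

/-- Parity sequences representing the components: one for each even sequence, and a single
odd one. -/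
def representative (k : ℕ) : Option (Fin k → Bool) → ℕ → Bool
  | none => fun n => decide (n ≠ 0)
  | some q => fun n => if h : 0 < n ∧ n < k + 1 then q ⟨n - 1, by omega⟩ else false

theorem representative_zero (k : ℕ) (o : Option (Fin k → Bool)) :
    representative k o 0 = false := by
  cases o <;> simp [representative]

theorem representative_last (k : ℕ) (o : Option (Fin k → Bool)) :
    representative k o (k + 1) = o.isNone := by
  cases o <;> simp [representative]

theorem eq_representative {k : ℕ} {p : ℕ → Bool} (hp : p 0 = false) (hpk : p (k + 1) = false)
    {n : ℕ} (hn : n < k + 2) : p n = representative k (some fun i => p (i + 1)) n := by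
  by_cases h : 0 < n ∧ n < k + 1
  · simp [representative, h, Nat.sub_add_cancel h.1]
  · have : n = 0 ∨ n = k + 1 := by omega
    rcases this with rfl | rfl <;> simp [representative, hp, hpk]

theorem representative_injective {k : ℕ} {o o' : Option (Fin k → Bool)}
    (h : ∀ n < k + 2, representative k o n = representative k o' n) : o = o' := by
  have hl := h (k + 1) (by omega)
  rw [representative_last, representative_last] at hl
  rcases o with _ | q <;> rcases o' with _ | q'
  · rfl
  · simp at hl
  · simp at hl
  · congr 1
    funext i
    simpa [representative] using h (i + 1) (by omega)

/-- The component of the coloring complex attached to a representative. -/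
def component (k : ℕ) (o : Option (Fin k → Bool)) :
    (colorComplex (Qk' k)).ConnectedComponent :=
  (colorComplex (Qk' k)).connectedComponentMk (rainbowClass k (representative k o) 0)

theorem component_injective (k : ℕ) : Function.Injective (component k) := by
  have key : ∀ o q, component k (some q) = component k o → some q = o := by
    intro o q h
    obtain ⟨d, hd⟩ := exists_eq_of_reachable (representative_zero k _)
      (representative_last k (some q)) (SimpleGraph.ConnectedComponent.exact h) ⟨0, rfl⟩
    exact representative_injective fun n hn => (eq_of_rainbow_preimage_eq
      (representative_zero k _) (representative_zero k _) hd hn).symm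
  rintro (_ | q) o h
  · rcases o with _ | q
    · rfl
    · exact (key _ _ h.symm).symm
  · exact key _ _ h

theorem component_surjective (k : ℕ) : Function.Surjective (component k) := by
  intro C
  induction C using SimpleGraph.ConnectedComponent.ind with | _ A
  obtain ⟨_, f, c, hf, hA⟩ := A.2
  suffices h : ∃ o, (colorComplex (Qk' k)).Reachable (rainbowClass k (representative k o) 0) A from
    h.imp fun o ho => SimpleGraph.ConnectedComponent.sound ho
  obtain ⟨p, σ, hp, rfl | ⟨hpk, rfl⟩⟩ := exists_eq_rainbow_or_striped hf <;>
    rw [preimage_perm_comp] at hA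
  · rcases hpk : p (k + 1) with _ | _
    · rw [rainbow_congr fun n => eq_representative hp hpk] at hA
      exact ⟨_, reachable_of_common (isProperColoring_rainbow k _) rfl hA⟩
    · exact ⟨none, (reachable_rainbowClass_of_odd (representative_zero k _)
        (representative_last k none) hp hpk).trans
        (reachable_of_common (isProperColoring_rainbow k p) rfl hA)⟩
  · exact ⟨none, (reachable_rainbowClass_of_odd (representative_zero k _)
      (representative_last k none) hp hpk).trans
      (reachable_of_common (isProperColoring_striped hp hpk) (striped_preimage_zero k p).symm hA)⟩

end QkPrime

/-- The 4-coloring complex `B(Q_k')` has exactly `2^k + 1` connected components. -/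
theorem card_components_colorComplex_Qk' (k : ℕ) :
    Nat.card ((colorComplex (Qk' k)).ConnectedComponent) = 2 ^ k + 1 := by
  rw [← Nat.card_congr (Equiv.ofBijective _
    ⟨QkPrime.component_injective k, QkPrime.component_surjective k⟩)]
  simp
end

section
/- For every integer k ≥ 0, the 4-coloring complex B(Q_k) has exactly one connected component that contains color classes of more than one coloring-partition; this component contains the color classes of exactly 2^{k+1} coloring-partitions, all of which are odd; each of the remaining 2^k connected components consists precisely of the four color classes of a single coloring-partition, which is even. -/
/-- Generating relation for the triangulation `Q_k`.  The vertex `(i, 0)` is `a_i`,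
`(i, 1)` is `b_i`, `(i, 2)` is `c_i` and `(i, 3)` is `d_i`.  Edges: the 4-cycles
`a_i b_i c_i d_i`, connecting edges between consecutive cycles, and the chords
`a_0 c_0` and `a_{k+1} c_{k+1}`. -/
def qkRel (k : ℕ) (u v : Fin (k + 2) × Fin 4) : Prop :=
  (u.1 = v.1 ∧ v.2 = u.2 + 1) ∨
  ((v.1 : ℕ) = (u.1 : ℕ) + 1 ∧ (v.2 = u.2 ∨ v.2 = u.2 + 1)) ∨
  ((u.1 : ℕ) = 0 ∧ (v.1 : ℕ) = 0 ∧ u.2 = 0 ∧ v.2 = 2) ∨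
  ((u.1 : ℕ) = k + 1 ∧ (v.1 : ℕ) = k + 1 ∧ u.2 = 0 ∧ v.2 = 2)

/-- The triangulation `Q_k`. -/
def Qk (k : ℕ) : SimpleGraph (Fin (k + 2) × Fin 4) := SimpleGraph.fromRel (qkRel k)

/-- A coloring-partition `P` is even if `J_a(f)` is even for every color `a` and every
proper 4-coloring `f` inducing `P`. -/
def EvenPartition {V : Type*} (G : SimpleGraph V) (P : Set (Set V)) : Prop :=
  ∀ f, IsProperColoring G f → colPart f = P → ∀ a, Even (Jcol G f a)

/-- A coloring-partition `P` is odd if `J_a(f)` is odd for every color `a` and every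
proper 4-coloring `f` inducing `P`. -/
def OddPartition {V : Type*} (G : SimpleGraph V) (P : Set (Set V)) : Prop :=
  ∀ f, IsProperColoring G f → colPart f = P → ∀ a, Odd (Jcol G f a)

/-- The set of coloring-partitions of `Q_k` having a color class in the connected
component `K` of the coloring complex `B(Q_k)`. -/
def meetsQk (k : ℕ) (K : (colorComplex (Qk k)).ConnectedComponent) :
    Set (Set (Set (Fin (k + 2) × Fin 4))) :=
  {P | IsColoringPartition (Qk k) P ∧
    ∃ A : colorClasses (Qk k), (colorComplex (Qk k)).connectedComponentMk A = K ∧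
      (A : Set (Fin (k + 2) × Fin 4)) ∈ P}

/-! ### Color classes and components of the coloring complex -/

lemma preimage_mem_colPart {V : Type*} (f : V → Fin 4) (v : V) : f ⁻¹' {f v} ∈ colPart f :=
  ⟨⟨v, rfl⟩, f v, rfl⟩

lemma mem_colPart_iff {V : Type*} {f : V → Fin 4} {A : Set V} :
    A ∈ colPart f ↔ ∃ v, A = f ⁻¹' {f v} := by
  constructor
  · rintro ⟨⟨v, hv⟩, c, rfl⟩
    obtain rfl : f v = c := hv
    exact ⟨v, rfl⟩
  · rintro ⟨v, rfl⟩
    exact preimage_mem_colPart f v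

lemma eq_preimage_of_mem_colPart {V : Type*} {f : V → Fin 4} {A : Set V} (hA : A ∈ colPart f)
    {v : V} (hv : v ∈ A) : A = f ⁻¹' {f v} := by
  obtain ⟨-, c, rfl⟩ := hA
  obtain rfl : f v = c := hv
  rfl

lemma preimage_eq_of_colPart_eq {V : Type*} {f g : V → Fin 4} (h : colPart f = colPart g)
    (v : V) : f ⁻¹' {f v} = g ⁻¹' {g v} :=
  eq_preimage_of_mem_colPart (h ▸ preimage_mem_colPart f v) rfl

lemma colPart_perm_comp {V : Type*} (π : Equiv.Perm (Fin 4)) (f : V → Fin 4) :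
    colPart (π ∘ f) = colPart f := by
  ext A
  rw [mem_colPart_iff, mem_colPart_iff]
  have : ∀ v, (π ∘ f) ⁻¹' {(π ∘ f) v} = f ⁻¹' {f v} := by
    intro v; ext w; simp
  simp only [this]

lemma exists_perm_of_colPart_eq {V : Type*} {f g : V → Fin 4} (h : colPart f = colPart g)
    (hg : Function.Surjective g) : ∃ π : Equiv.Perm (Fin 4), f = π ∘ g := by
  have key : ∀ v w, f v = f w ↔ g v = g w := by
    intro v w
    have := Set.ext_iff.1 (preimage_eq_of_colPart_eq h w) v
    simpa using this
  choose r hr using hg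
  have hinj : Function.Injective (fun c => f (r c)) := by
    intro c d hcd
    have := (key _ _).1 hcd
    rwa [hr, hr] at this
  refine ⟨Equiv.ofBijective _ (Finite.injective_iff_bijective.1 hinj), ?_⟩
  funext v
  exact (key _ _).2 (hr (g v)).symm

lemma IsProperColoring.mem_colorClasses {V : Type*} {G : SimpleGraph V} {f : V → Fin 4}
    (hf : IsProperColoring G f) {A : Set V} (hA : A ∈ colPart f) : A ∈ colorClasses G :=
  ⟨hA.1, f, hA.2.imp fun _ hc => ⟨hf, hc⟩⟩

lemma exists_coloring_of_class {V : Type*} {G : SimpleGraph V} (A : colorClasses G) :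
    ∃ f, IsProperColoring G f ∧ (A : Set V) ∈ colPart f := by
  obtain ⟨A, hne, f, c, hf, h⟩ := A
  exact ⟨f, hf, hne, c, h⟩

lemma exists_coloring_of_adj {V : Type*} {G : SimpleGraph V} {A B : colorClasses G}
    (h : (colorComplex G).Adj A B) :
    ∃ f, IsProperColoring G f ∧ (A : Set V) ∈ colPart f ∧ (B : Set V) ∈ colPart f := by
  rw [colorComplex, SimpleGraph.fromRel_adj] at h
  rcases h with ⟨-, ⟨f, hf, hA, hB⟩ | ⟨f, hf, hB, hA⟩⟩ <;>
  exact ⟨f, hf, ⟨A.2.1, hA⟩, ⟨B.2.1, hB⟩⟩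

lemma component_eq_of_mem_colPart {V : Type*} {G : SimpleGraph V} {f : V → Fin 4}
    (hf : IsProperColoring G f) {A B : colorClasses G} (hA : (A : Set V) ∈ colPart f)
    (hB : (B : Set V) ∈ colPart f) :
    (colorComplex G).connectedComponentMk A = (colorComplex G).connectedComponentMk B := by
  rw [SimpleGraph.ConnectedComponent.eq]
  by_cases h : A = B
  · rw [h]
  · apply SimpleGraph.Adj.reachable
    rw [colorComplex, SimpleGraph.fromRel_adj]
    exact ⟨h, Or.inl ⟨f, hf, hA.2, hB.2⟩⟩

/-- If every proper coloring sharing a class with `g` induces the same partition as `g`, then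
the classes of `g` form a connected component. -/
lemma component_eq_iff_of_isolated {V : Type*} {G : SimpleGraph V} {g : V → Fin 4}
    (hg : IsProperColoring G g)
    (hiso : ∀ f, IsProperColoring G f → ∀ A ∈ colPart f, A ∈ colPart g → colPart f = colPart g)
    {A B : colorClasses G} (hA : (A : Set V) ∈ colPart g) :
    (colorComplex G).connectedComponentMk B = (colorComplex G).connectedComponentMk A ↔
      (B : Set V) ∈ colPart g := by
  constructor
  · intro h
    rw [eq_comm, SimpleGraph.ConnectedComponent.eq, SimpleGraph.reachable_iff_reflTransGen] at h
    induction h with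
    | refl => exact hA
    | tail _ hadj ih =>
      obtain ⟨f, hf, h1, h2⟩ := exists_coloring_of_adj hadj
      rwa [← hiso f hf _ h1 ih]
  · intro h
    exact component_eq_of_mem_colPart hg h hA

/-! ### Kempe counts under recoloring -/

/-- The total number of Kempe chains of a coloring. -/
noncomputable def kempeTotal {V : Type*} (G : SimpleGraph V) (f : V → Fin 4) : ℕ :=
  kempeCount G f 0 1 + kempeCount G f 1 2 + kempeCount G f 2 3 + kempeCount G f 3 0 +
    kempeCount G f 0 2 + kempeCount G f 1 3

lemma kempeCount_comm {V : Type*} (G : SimpleGraph V) (f : V → Fin 4) (a b : Fin 4) :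
    kempeCount G f a b = kempeCount G f b a := by
  have : {v | f v = a ∨ f v = b} = {v | f v = b ∨ f v = a} := by ext v; exact or_comm
  rw [kempeCount, this, kempeCount]

lemma kempeCount_perm_comp {V : Type*} (G : SimpleGraph V) (f : V → Fin 4)
    (π : Equiv.Perm (Fin 4)) (a b : Fin 4) :
    kempeCount G (π ∘ f) a b = kempeCount G f (π.symm a) (π.symm b) := by
  have : {v | (π ∘ f) v = a ∨ (π ∘ f) v = b} = {v | f v = π.symm a ∨ f v = π.symm b} := by
    ext v
    simp [Equiv.eq_symm_apply]
  rw [kempeCount, this, kempeCount]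

lemma two_mul_kempeTotal {V : Type*} (G : SimpleGraph V) (f : V → Fin 4) :
    2 * kempeTotal G f = ∑ a, ∑ b, if a = b then 0 else kempeCount G f a b := by
  simp [Fin.sum_univ_four, kempeTotal, kempeCount_comm G f 1 0, kempeCount_comm G f 2 0,
    kempeCount_comm G f 2 1, kempeCount_comm G f 0 3, kempeCount_comm G f 3 1,
    kempeCount_comm G f 3 2]
  ring

lemma kempeTotal_perm_comp {V : Type*} (G : SimpleGraph V) (f : V → Fin 4)
    (π : Equiv.Perm (Fin 4)) : kempeTotal G (π ∘ f) = kempeTotal G f := by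
  apply Nat.eq_of_mul_eq_mul_left (Nat.succ_pos 1)
  rw [two_mul_kempeTotal, two_mul_kempeTotal, ← Equiv.sum_comp π]
  refine Finset.sum_congr rfl fun a _ => ?_
  rw [← Equiv.sum_comp π]
  refine Finset.sum_congr rfl fun b _ => ?_
  simp [kempeCount_perm_comp]

lemma even_Jcol_iff {V : Type*} (G : SimpleGraph V) (f : V → Fin 4) (a : Fin 4) :
    Even (Jcol G f a) ↔ Even (kempeTotal G f) := by
  have h0 : (Finset.univ.erase 0 : Finset (Fin 4)) = {1, 2, 3} := by decide
  have h1 : (Finset.univ.erase 1 : Finset (Fin 4)) = {0, 2, 3} := by decide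
  have h2 : (Finset.univ.erase 2 : Finset (Fin 4)) = {0, 1, 3} := by decide
  have h3 : (Finset.univ.erase 3 : Finset (Fin 4)) = {0, 1, 2} := by decide
  have key : ∃ m : ℤ, Jcol G f a = kempeTotal G f - 2 * m := by
    fin_cases a
    · exact ⟨kempeCount G f 1 2 + kempeCount G f 2 3 + kempeCount G f 1 3, by
        simp [Jcol, kempeTotal, Finset.sum_filter, h0, kempeCount_comm G f 3 0]; ring⟩
    · exact ⟨kempeCount G f 0 2 + kempeCount G f 2 3 + kempeCount G f 3 0, by
        simp [Jcol, kempeTotal, Finset.sum_filter, h1, kempeCount_comm G f 3 0,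
          kempeCount_comm G f 1 0]; ring⟩
    · exact ⟨kempeCount G f 0 1 + kempeCount G f 1 3 + kempeCount G f 3 0, by
        simp [Jcol, kempeTotal, Finset.sum_filter, h2, kempeCount_comm G f 3 0,
          kempeCount_comm G f 2 0, kempeCount_comm G f 2 1]; ring⟩
    · exact ⟨kempeCount G f 0 1 + kempeCount G f 1 2 + kempeCount G f 0 2, by
        simp [Jcol, kempeTotal, Finset.sum_filter, h3, kempeCount_comm G f 3 1,
          kempeCount_comm G f 3 2]; ring⟩
  obtain ⟨m, hm⟩ := key
  rw [hm, ← Int.even_coe_nat (kempeTotal G f)]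
  simp [Int.even_sub]

lemma evenPartition_of_kempeTotal {V : Type*} {G : SimpleGraph V} {g : V → Fin 4}
    (hg : Function.Surjective g) (h : Even (kempeTotal G g)) : EvenPartition G (colPart g) := by
  intro f _ hfg a
  obtain ⟨π, rfl⟩ := exists_perm_of_colPart_eq hfg hg
  rwa [even_Jcol_iff, kempeTotal_perm_comp]

lemma oddPartition_of_kempeTotal {V : Type*} {G : SimpleGraph V} {g : V → Fin 4}
    (hg : Function.Surjective g) (h : Odd (kempeTotal G g)) : OddPartition G (colPart g) := by
  intro f _ hfg a
  obtain ⟨π, rfl⟩ := exists_perm_of_colPart_eq hfg hg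
  rwa [← Int.not_even_iff_odd, even_Jcol_iff, kempeTotal_perm_comp, Nat.not_even_iff_odd]

/-! ### Adjacency in `Q_k` -/

lemma qkRel.ne {k : ℕ} {u v : Fin (k + 2) × Fin 4} (h : qkRel k u v) : u ≠ v := by
  rintro rfl
  rcases h with ⟨-, h⟩ | ⟨h, -⟩ | ⟨-, -, h, h'⟩ | ⟨-, -, h, h'⟩
  · exact absurd h (by generalize u.2 = j; revert j; decide)
  · omega
  · rw [h] at h'; exact absurd h' (by decide)
  · rw [h] at h'; exact absurd h' (by decide)

lemma Qk_adj_of_rel {k : ℕ} {u v : Fin (k + 2) × Fin 4} (h : qkRel k u v) : (Qk k).Adj u v := by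
  rw [Qk, SimpleGraph.fromRel_adj]
  exact ⟨h.ne, Or.inl h⟩

lemma rel_or_rel_of_Qk_adj {k : ℕ} {u v : Fin (k + 2) × Fin 4} (h : (Qk k).Adj u v) :
    qkRel k u v ∨ qkRel k v u := by
  rw [Qk, SimpleGraph.fromRel_adj] at h
  exact h.2

lemma isProperColoring_Qk_of_rel {k : ℕ} {f : Fin (k + 2) × Fin 4 → Fin 4}
    (h : ∀ u v, qkRel k u v → f u ≠ f v) : IsProperColoring (Qk k) f := by
  intro u v huv
  rcases rel_or_rel_of_Qk_adj huv with h' | h'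
  · exact h _ _ h'
  · exact (h _ _ h').symm

/-! ### Standard colorings of `Q_k` -/

/-- The position in layer `i` of a color starting at `a_0`, when `s` records the parities of
the positions. -/
def layerPos (s : ℕ → Bool) : ℕ → Fin 4
  | 0 => 0
  | i + 1 => if s (i + 1) = s i then layerPos s i + 2 else layerPos s i + 3

/-- The parity of a position on a 4-cycle. -/
def posParity (p : Fin 4) : Bool := decide (p = 1 ∨ p = 3)

lemma layerPos_congr {s t : ℕ → Bool} {n : ℕ} (h : ∀ i ≤ n, s i = t i) :
    layerPos s n = layerPos t n := by
  induction n with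
  | zero => rfl
  | succ n ih =>
    simp only [layerPos, ih fun i hi => h i (by omega), h (n + 1) le_rfl, h n (by omega)]

lemma posParity_layerPos {s : ℕ → Bool} (h0 : s 0 = false) (i : ℕ) :
    posParity (layerPos s i) = s i := by
  induction i with
  | zero => rw [h0]; rfl
  | succ n ih =>
    simp only [layerPos]
    revert ih
    generalize layerPos s n = p
    generalize s n = x
    generalize s (n + 1) = y
    revert p x y
    decide

lemma layerPos_succ (s : ℕ → Bool) (i : ℕ) :
    layerPos s (i + 1) = layerPos s i + 2 ∨ layerPos s (i + 1) = layerPos s i + 3 := by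
  simp only [layerPos]
  split <;> simp

/-- The coloring that uses four colors on each layer. -/
def rainbow (k : ℕ) (s : ℕ → Bool) (v : Fin (k + 2) × Fin 4) : Fin 4 := v.2 - layerPos s v.1

/-- The pattern `p` gets color `0`, its antipode color `2`, and the other two vertices color
`1` or `3`. -/
def pinchLayer (b : Bool) (p j : Fin 4) : Fin 4 :=
  if j = p then 0 else if j = p + 2 then 2 else if b then 1 else 3

/-- Whether `i` is even. -/
def evenLayer (i : ℕ) : Bool := decide (i % 2 = 0)

lemma evenLayer_succ (i : ℕ) : evenLayer (i + 1) = !evenLayer i := by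
  rcases Nat.mod_two_eq_zero_or_one i with h | h <;> simp [evenLayer, Nat.add_mod, h]

/-- The coloring that uses three colors on each layer. -/
def pinched (k : ℕ) (s : ℕ → Bool) (v : Fin (k + 2) × Fin 4) : Fin 4 :=
  pinchLayer (evenLayer v.1) (layerPos s v.1) v.2

lemma rainbow_surjective (k : ℕ) (s : ℕ → Bool) : Function.Surjective (rainbow k s) := by
  intro c
  exact ⟨(0, c), by simp [rainbow, layerPos]⟩

lemma pinched_surjective (k : ℕ) (s : ℕ → Bool) : Function.Surjective (pinched k s) := by
  intro c
  have h1 : ((1 : Fin (k + 2)) : ℕ) = 1 := by simp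
  fin_cases c
  · exact ⟨(0, 0), rfl⟩
  · exact ⟨(0, 1), rfl⟩
  · exact ⟨(0, 2), rfl⟩
  · refine ⟨(1, layerPos s 1 + 1), ?_⟩
    simp only [pinched, h1]
    generalize layerPos s 1 = p
    revert p
    decide

lemma rainbow_isProper (k : ℕ) (s : ℕ → Bool) : IsProperColoring (Qk k) (rainbow k s) := by
  apply isProperColoring_Qk_of_rel
  rintro ⟨i, j⟩ ⟨i', j'⟩ (⟨h, h'⟩ | ⟨h, h'⟩ | ⟨h, h', h2, h3⟩ | ⟨h, h', h2, h3⟩) <;>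
    simp only at * <;> simp only [rainbow]
  · subst h h'
    generalize layerPos s i = p
    revert p j; decide
  · rw [h]
    have := layerPos_succ s i
    revert this h'
    generalize layerPos s i = p
    generalize layerPos s (i + 1) = q
    revert p q j j'; decide
  all_goals
    subst h2 h3
    rw [h, h']
    generalize layerPos s _ = p
    revert p; decide

lemma pinched_isProper {k : ℕ} {s : ℕ → Bool} (h0 : s 0 = false) (hk : s (k + 1) = false) :
    IsProperColoring (Qk k) (pinched k s) := by
  apply isProperColoring_Qk_of_rel
  rintro ⟨i, j⟩ ⟨i', j'⟩ (⟨h, h'⟩ | ⟨h, h'⟩ | ⟨h, h', h2, h3⟩ | ⟨h, h', h2, h3⟩) <;>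
    simp only at * <;> simp only [pinched]
  · subst h h'
    generalize layerPos s i = p
    generalize evenLayer i = b
    revert b p j; decide
  · rw [h, evenLayer_succ]
    have := layerPos_succ s i
    revert this h'
    generalize layerPos s i = p
    generalize evenLayer i = b
    generalize layerPos s (i + 1) = q
    revert b p q j j'; decide
  · subst h2 h3
    rw [h, h', layerPos]
    generalize evenLayer 0 = b
    revert b; decide
  · subst h2 h3
    rw [h, h']
    have := posParity_layerPos h0 (k + 1)
    rw [hk] at this
    revert this
    generalize layerPos s (k + 1) = p
    generalize evenLayer (k + 1) = b
    revert b p; decide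

/-! ### Classification of the proper colorings of `Q_k` -/

lemma exists_eq_vec_four (y : Fin 4 → Fin 4) : ∃ a b c d, y = ![a, b, c, d] :=
  ⟨y 0, y 1, y 2, y 3, by funext j; fin_cases j <;> rfl⟩

lemma shift_layer_step {p : Fin 4} {y : Fin 4 → Fin 4}
    (h1 : ∀ j, j - p ≠ y j) (h2 : ∀ j, j - p ≠ y (j + 1)) (h3 : ∀ j, y j ≠ y (j + 1)) :
    (∀ j, y j = j - (p + 2)) ∨ (∀ j, y j = j - (p + 3)) := by
  obtain ⟨a, b, c, d, rfl⟩ := exists_eq_vec_four y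
  revert p a b c d
  decide +kernel

lemma pinch_layer_step {b : Bool} {p : Fin 4} {y : Fin 4 → Fin 4}
    (h1 : ∀ j, pinchLayer b p j ≠ y j) (h2 : ∀ j, pinchLayer b p j ≠ y (j + 1))
    (h3 : ∀ j, y j ≠ y (j + 1)) :
    (∀ j, y j = pinchLayer (!b) (p + 2) j) ∨ (∀ j, y j = pinchLayer (!b) (p + 3) j) := by
  obtain ⟨y0, y1, y2, y3, rfl⟩ := exists_eq_vec_four y
  revert b p y0 y1 y2 y3
  decide +kernel

/-- The parities of the positions of color `0` in a coloring of `Q_k`. -/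
def zeroParity {k : ℕ} (f : Fin (k + 2) × Fin 4 → Fin 4) (i : ℕ) : Bool :=
  if h : i < k + 2 then decide (f (⟨i, h⟩, 1) = 0 ∨ f (⟨i, h⟩, 3) = 0) else false

lemma IsProperColoring.layer_ne {k : ℕ} {f : Fin (k + 2) × Fin 4 → Fin 4}
    (hf : IsProperColoring (Qk k) f) (i : Fin (k + 2)) (j : Fin 4) : f (i, j) ≠ f (i, j + 1) :=
  hf (Qk_adj_of_rel (Or.inl ⟨rfl, rfl⟩))

lemma IsProperColoring.up_ne {k : ℕ} {f : Fin (k + 2) × Fin 4 → Fin 4}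
    (hf : IsProperColoring (Qk k) f) {i : ℕ} (h : i + 1 < k + 2) (j : Fin 4) :
    f (⟨i, by omega⟩, j) ≠ f (⟨i + 1, h⟩, j) :=
  hf (Qk_adj_of_rel (Or.inr (Or.inl ⟨rfl, Or.inl rfl⟩)))

lemma IsProperColoring.up_succ_ne {k : ℕ} {f : Fin (k + 2) × Fin 4 → Fin 4}
    (hf : IsProperColoring (Qk k) f) {i : ℕ} (h : i + 1 < k + 2) (j : Fin 4) :
    f (⟨i, by omega⟩, j) ≠ f (⟨i + 1, h⟩, j + 1) :=
  hf (Qk_adj_of_rel (Or.inr (Or.inl ⟨rfl, Or.inr rfl⟩)))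

lemma IsProperColoring.eq_rainbow {k : ℕ} {f : Fin (k + 2) × Fin 4 → Fin 4}
    (hf : IsProperColoring (Qk k) f) (h0 : ∀ j, f (0, j) = j) :
    zeroParity f 0 = false ∧ f = rainbow k (zeroParity f) := by
  have hs0 : zeroParity f 0 = false := by
    rw [zeroParity, dif_pos (by omega)]
    change decide (f (0, 1) = 0 ∨ f (0, 3) = 0) = false
    rw [h0, h0]
    decide
  refine ⟨hs0, ?_⟩
  have main : ∀ i (hi : i < k + 2), ∀ j, f (⟨i, hi⟩, j) = j - layerPos (zeroParity f) i := by
    intro i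
    induction i with
    | zero => intro _ j; simpa [layerPos] using h0 j
    | succ i ih =>
      intro hi j
      have hi' : i < k + 2 := by omega
      have hz : zeroParity f (i + 1) =
          decide (f (⟨i + 1, hi⟩, 1) = 0 ∨ f (⟨i + 1, hi⟩, 3) = 0) := by
        rw [zeroParity, dif_pos hi]
      have hp := posParity_layerPos hs0 i
      have step := shift_layer_step (p := layerPos (zeroParity f) i)
        (y := fun j => f (⟨i + 1, hi⟩, j))
        (fun j => by rw [← ih hi']; exact hf.up_ne hi j)
        (fun j => by rw [← ih hi']; exact hf.up_succ_ne hi j)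
        (fun j => hf.layer_ne _ j)
      rw [layerPos]
      rcases step with h | h <;> rw [h] <;> simp only [h] at hz <;> rw [hz, ← hp] <;>
      · generalize layerPos (zeroParity f) i = p
        revert p j; decide
  funext ⟨i, j⟩
  exact main i i.2 j

lemma IsProperColoring.eq_pinched {k : ℕ} {f : Fin (k + 2) × Fin 4 → Fin 4}
    (hf : IsProperColoring (Qk k) f) (h0 : ∀ j, f (0, j) = pinchLayer true 0 j) :
    zeroParity f 0 = false ∧ zeroParity f (k + 1) = false ∧ f = pinched k (zeroParity f) := by
  have hs0 : zeroParity f 0 = false := by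
    rw [zeroParity, dif_pos (by omega)]
    change decide (f (0, 1) = 0 ∨ f (0, 3) = 0) = false
    rw [h0, h0]
    decide
  have main : ∀ i (hi : i < k + 2), ∀ j, f (⟨i, hi⟩, j) =
      pinchLayer (evenLayer i) (layerPos (zeroParity f) i) j := by
    intro i
    induction i with
    | zero => intro _ j; exact h0 j
    | succ i ih =>
      intro hi j
      have hi' : i < k + 2 := by omega
      have hz : zeroParity f (i + 1) =
          decide (f (⟨i + 1, hi⟩, 1) = 0 ∨ f (⟨i + 1, hi⟩, 3) = 0) := by
        rw [zeroParity, dif_pos hi]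
      have hp := posParity_layerPos hs0 i
      have step := pinch_layer_step (p := layerPos (zeroParity f) i) (b := evenLayer i)
        (y := fun j => f (⟨i + 1, hi⟩, j))
        (fun j => by rw [← ih hi']; exact hf.up_ne hi j)
        (fun j => by rw [← ih hi']; exact hf.up_succ_ne hi j)
        (fun j => hf.layer_ne _ j)
      rw [layerPos, evenLayer_succ]
      rcases step with h | h <;> rw [h] <;> simp only [h] at hz <;> rw [hz, ← hp] <;>
      · generalize layerPos (zeroParity f) i = p
        generalize evenLayer i = b
        revert b p j; decide
  refine ⟨hs0, ?_, ?_⟩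
  · have hne : f (Fin.last (k + 1), 0) ≠ f (Fin.last (k + 1), 2) :=
      hf (Qk_adj_of_rel (Or.inr (Or.inr (Or.inr ⟨rfl, rfl, rfl, rfl⟩))))
    rw [← posParity_layerPos hs0]
    have e : ∀ j, f (Fin.last (k + 1), j) = _ := main (k + 1) (by omega)
    rw [e, e] at hne
    revert hne
    generalize layerPos (zeroParity f) (k + 1) = p
    generalize evenLayer (k + 1) = b
    revert b p; decide
  · funext ⟨i, j⟩
    exact main i i.2 j

/-- The standard representatives of the proper colorings of `Q_k`. -/
inductive IsStandard (k : ℕ) : (Fin (k + 2) × Fin 4 → Fin 4) → Prop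
  | rainbow (s : ℕ → Bool) (h0 : s 0 = false) : IsStandard k (rainbow k s)
  | pinched (s : ℕ → Bool) (h0 : s 0 = false) (hk : s (k + 1) = false) :
      IsStandard k (pinched k s)

lemma IsProperColoring.perm_comp {V : Type*} {G : SimpleGraph V} {f : V → Fin 4}
    (hf : IsProperColoring G f) (π : Equiv.Perm (Fin 4)) : IsProperColoring G (π ∘ f) :=
  fun _ _ h => π.injective.ne (hf h)

lemma exists_standard_of_perm_comp {k : ℕ} {f : Fin (k + 2) × Fin 4 → Fin 4}
    (hf : IsProperColoring (Qk k) f) (π : Equiv.Perm (Fin 4))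
    (h : (∀ j, f (0, j) = π j) ∨ (∀ j, f (0, j) = π (pinchLayer true 0 j))) :
    ∃ g, IsStandard k g ∧ colPart f = colPart g := by
  have hg := hf.perm_comp π.symm
  refine ⟨π.symm ∘ f, ?_, (colPart_perm_comp _ _).symm⟩
  rcases h with h | h
  · obtain ⟨h0, e⟩ := hg.eq_rainbow fun j => by simp [h]
    rw [e]
    exact .rainbow _ h0
  · obtain ⟨h0, hk, e⟩ := hg.eq_pinched fun j => by simp [h]
    rw [e]
    exact .pinched _ h0 hk

lemma IsProperColoring.exists_standard {k : ℕ} {f : Fin (k + 2) × Fin 4 → Fin 4}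
    (hf : IsProperColoring (Qk k) f) : ∃ g, IsStandard k g ∧ colPart f = colPart g := by
  have h02 : f (0, 0) ≠ f (0, 2) :=
    hf (Qk_adj_of_rel (Or.inr (Or.inr (Or.inl ⟨rfl, rfl, rfl, rfl⟩))))
  have h := hf.layer_ne 0
  have key : ∀ y0 y1 y2 y3 : Fin 4, y0 ≠ y2 → y0 ≠ y1 → y1 ≠ y2 → y2 ≠ y3 → y3 ≠ y0 →
      (y1 ≠ y3 ∧ Function.Injective ![y0, y1, y2, y3]) ∨
        (y1 = y3 ∧ ∃ z, Function.Injective ![y0, y1, y2, z]) := by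
    decide +kernel
  rcases key (f (0, 0)) (f (0, 1)) (f (0, 2)) (f (0, 3)) h02 (h 0) (h 1) (h 2) (h 3) with
    ⟨-, hinj⟩ | ⟨h13, z, hinj⟩
  · refine exists_standard_of_perm_comp hf
      (Equiv.ofBijective _ (Finite.injective_iff_bijective.1 hinj)) (Or.inl fun j => ?_)
    fin_cases j <;> rfl
  · refine exists_standard_of_perm_comp hf
      (Equiv.ofBijective _ (Finite.injective_iff_bijective.1 hinj)) (Or.inr fun j => ?_)
    fin_cases j
    · rfl
    · rfl
    · rfl
    · exact h13.symm

/-! ### Counting Kempe chains in `Q_k` -/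

lemma card_connectedComponent_eq {V ι : Type*} {G : SimpleGraph V} (h : V → ι)
    (hsurj : Function.Surjective h) (hadj : ∀ u v, G.Adj u v → h u = h v)
    (hreach : ∀ u v, h u = h v → G.Reachable u v) :
    Nat.card G.ConnectedComponent = Nat.card ι := by
  have hr : ∀ u v, G.Reachable u v → h u = h v := by
    intro u v huv
    rw [SimpleGraph.reachable_iff_reflTransGen] at huv
    induction huv with
    | refl => rfl
    | tail _ hstep ih => exact ih.trans (hadj _ _ hstep)
  refine Nat.card_congr (Equiv.ofBijective (Quot.lift h hr) ⟨?_, ?_⟩)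
  · rintro ⟨u⟩ ⟨v⟩ huv
    exact Quot.sound (hreach u v huv)
  · intro i
    obtain ⟨u, rfl⟩ := hsurj i
    exact ⟨Quot.mk _ u, rfl⟩

/-- Reachability inside the subgraph induced on `X`. -/
def ReachIn {V : Type*} (G : SimpleGraph V) (X : Set V) (u v : V) : Prop :=
  ∃ (hu : u ∈ X) (hv : v ∈ X), (G.induce X).Reachable ⟨u, hu⟩ ⟨v, hv⟩

namespace ReachIn

variable {V : Type*} {G : SimpleGraph V} {X : Set V} {u v w : V}

lemma refl (hu : u ∈ X) : ReachIn G X u u := ⟨hu, hu, .refl _⟩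

lemma symm (h : ReachIn G X u v) : ReachIn G X v u :=
  let ⟨hu, hv, h⟩ := h
  ⟨hv, hu, h.symm⟩

lemma trans (h : ReachIn G X u v) (h' : ReachIn G X v w) : ReachIn G X u w :=
  let ⟨hu, _, h⟩ := h
  let ⟨_, hw, h'⟩ := h'
  ⟨hu, hw, h.trans h'⟩

lemma of_adj (hu : u ∈ X) (hv : v ∈ X) (h : G.Adj u v) : ReachIn G X u v :=
  ⟨hu, hv, SimpleGraph.Adj.reachable h⟩

end ReachIn

lemma card_component_induce_eq_one {V : Type*} {G : SimpleGraph V} {X : Set V} {u : V}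
    (hu : u ∈ X) (h : ∀ v ∈ X, ReachIn G X v u) :
    Nat.card (G.induce X).ConnectedComponent = 1 := by
  rw [card_connectedComponent_eq (fun _ => ()) (fun _ => ⟨⟨u, hu⟩, rfl⟩) (fun _ _ _ => rfl),
    Nat.card_unique]
  intro v w _
  obtain ⟨_, _, hv⟩ := h v v.2
  obtain ⟨_, _, hw⟩ := h w w.2
  exact hv.trans hw.symm

lemma adj_layer {k : ℕ} (i : Fin (k + 2)) (j : Fin 4) : (Qk k).Adj (i, j) (i, j + 1) :=
  Qk_adj_of_rel (Or.inl ⟨rfl, rfl⟩)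

lemma adj_up {k : ℕ} (i : Fin (k + 1)) {j j' : Fin 4} (h : j' = j ∨ j' = j + 1) :
    (Qk k).Adj (i.castSucc, j) (i.succ, j') :=
  Qk_adj_of_rel (Or.inr (Or.inl ⟨by simp, h⟩))

/-- A vertex set whose layers are paths with centre `c i`, consecutive layers being joined by an
edge, induces a connected subgraph. -/
lemma card_component_eq_one_of_layers {k : ℕ} {X : Set (Fin (k + 2) × Fin 4)} (c : ℕ → Fin 4)
    (hc : ∀ i : Fin (k + 2), (i, c i) ∈ X)
    (hX : ∀ (i : Fin (k + 2)) j, (i, j) ∈ X → j = c i ∨ j = c i + 1 ∨ j = c i + 3)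
    (hstep : ∀ i : Fin (k + 1), ∃ j j', (i.castSucc, j) ∈ X ∧ (i.succ, j') ∈ X ∧
      (j' = j ∨ j' = j + 1)) :
    Nat.card ((Qk k).induce X).ConnectedComponent = 1 := by
  have hcentre : ∀ (i : Fin (k + 2)) j, (i, j) ∈ X → ReachIn (Qk k) X (i, j) (i, c i) := by
    intro i j hj
    rcases hX i j hj with rfl | rfl | rfl
    · exact .refl hj
    · exact .of_adj hj (hc i) (adj_layer _ _).symm
    · refine .of_adj hj (hc i) ?_
      have := adj_layer i (c i + 3)
      rwa [add_assoc, show (3 + 1 : Fin 4) = 0 from rfl, add_zero] at this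
  have hbase : ∀ i : Fin (k + 2), ReachIn (Qk k) X (i, c i) (0, c (0 : Fin (k + 2))) := by
    intro i
    induction i using Fin.induction with
    | zero => exact .refl (hc 0)
    | succ i ih =>
      obtain ⟨j, j', hj, hj', hjj⟩ := hstep i
      exact (hcentre _ _ hj').symm.trans <|
        (ReachIn.of_adj hj' hj (adj_up i hjj).symm).trans <| (hcentre _ _ hj).trans ih
  exact card_component_induce_eq_one (hc 0) fun ⟨i, j⟩ h => (hcentre i j h).trans (hbase i)

/-- The vertices `r i` and `r i + 2` of every layer `i`. -/
def antipodalSet (k : ℕ) (r : ℕ → Fin 4) : Set (Fin (k + 2) × Fin 4) :=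
  {v | v.2 = r v.1 ∨ v.2 = r v.1 + 2}

lemma antipodal_reach {k : ℕ} {r : ℕ → Fin 4} (hr : ∀ i, r (i + 1) = r i ∨ r (i + 1) = r i + 1)
    {t : Fin 4} (ht : t = 0 ∨ t = 2) (i : Fin (k + 2)) :
    ReachIn (Qk k) (antipodalSet k r) (i, r i + t) (0, r 0 + t) := by
  have hmem : ∀ i : Fin (k + 2), (i, r i + t) ∈ antipodalSet k r := by
    intro i
    rcases ht with rfl | rfl <;> simp [antipodalSet]
  induction i using Fin.induction with
  | zero => exact .refl (hmem 0)
  | succ i ih =>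
    refine (ReachIn.of_adj (hmem _) (hmem _) (adj_up i ?_).symm).trans ih
    rcases hr i with h | h
    · left; simp [h]
    · right; simp [h, add_right_comm]

lemma antipodal_count_eq_one {k : ℕ} {r : ℕ → Fin 4}
    (hr : ∀ i, r (i + 1) = r i ∨ r (i + 1) = r i + 1)
    (hchord : posParity (r 0) = false ∨ posParity (r (k + 1)) = false) :
    Nat.card ((Qk k).induce (antipodalSet k r)).ConnectedComponent = 1 := by
  have hmem0 : ∀ i : Fin (k + 2), (i, r i + 0) ∈ antipodalSet k r := by
    intro i; simp [antipodalSet]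
  have hmem2 : ∀ i : Fin (k + 2), (i, r i + 2) ∈ antipodalSet k r := by
    intro i; simp [antipodalSet]
  have even : ∀ p : Fin 4, posParity p = false → (p = 0 ∨ p = 2) := by decide
  have chord : ∀ i : Fin (k + 2), ((i : ℕ) = 0 ∨ (i : ℕ) = k + 1) →
      posParity (r i) = false → ReachIn (Qk k) (antipodalSet k r) (i, r i + 0) (i, r i + 2) := by
    intro i hi hp
    refine .of_adj (hmem0 i) (hmem2 i) ?_
    have hadj : (Qk k).Adj (i, 0) (i, 2) := by
      refine Qk_adj_of_rel ?_
      rcases hi with hi | hi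
      · exact Or.inr (Or.inr (Or.inl ⟨hi, hi, rfl, rfl⟩))
      · exact Or.inr (Or.inr (Or.inr ⟨hi, hi, rfl, rfl⟩))
    rcases even _ hp with h | h <;> rw [h]
    · exact hadj
    · exact hadj.symm
  have hbase : ReachIn (Qk k) (antipodalSet k r) (0, r 0 + 2) (0, r 0 + 0) := by
    rcases hchord with h | h
    · exact (chord 0 (Or.inl rfl) h).symm
    · exact ((antipodal_reach hr (Or.inr rfl) (Fin.last (k + 1))).symm.trans
        (chord (Fin.last (k + 1)) (Or.inr rfl) h).symm).trans
        (antipodal_reach hr (Or.inl rfl) (Fin.last (k + 1)))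
  refine card_component_induce_eq_one (hmem0 0) ?_
  rintro ⟨i, j⟩ (h | h) <;> simp only at h <;> subst h
  · simpa using antipodal_reach hr (Or.inl rfl) i
  · exact (antipodal_reach hr (Or.inr rfl) i).trans hbase

lemma antipodal_count_eq_two {k : ℕ} {r : ℕ → Fin 4}
    (hr : ∀ i, r (i + 1) = r i ∨ r (i + 1) = r i + 1)
    (h0 : posParity (r 0) = true) (hk : posParity (r (k + 1)) = true) :
    Nat.card ((Qk k).induce (antipodalSet k r)).ConnectedComponent = 2 := by
  have hrel : ∀ u v, qkRel k u v → u ∈ antipodalSet k r → v ∈ antipodalSet k r →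
      (u.2 = r u.1 ↔ v.2 = r v.1) := by
    rintro ⟨i, j⟩ ⟨i', j'⟩ huv hu hv
    simp only [antipodalSet, Set.mem_ofPred_eq] at hu hv ⊢
    rcases huv with ⟨h, h'⟩ | ⟨h, h'⟩ | ⟨h, h', h2, h3⟩ | ⟨h, h', h2, h3⟩ <;> simp only at h h'
    · subst h h'
      revert hu hv
      generalize r i = p
      revert p j; decide
    · rw [h] at hv ⊢
      have := hr i
      revert hu hv h' this
      generalize r i = p
      generalize r (i + 1) = q
      revert p q j j'; decide
    · rw [h] at hu
      simp only at h2 h3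
      subst h2 h3
      exfalso
      revert hu h0
      generalize r 0 = p
      revert p; decide
    · rw [h] at hu
      simp only at h2 h3
      subst h2 h3
      exfalso
      revert hu hk
      generalize r (k + 1) = p
      revert p; decide
  rw [card_connectedComponent_eq (fun v => decide (v.1.2 = r v.1.1)), Nat.card_eq_fintype_card,
    Fintype.card_bool]
  · rintro (_ | _)
    · refine ⟨⟨(0, r 0 + 2), by simp [antipodalSet]⟩, ?_⟩
      simp
    · refine ⟨⟨(0, r 0), by simp [antipodalSet]⟩, ?_⟩
      simp
  · rintro ⟨u, hu⟩ ⟨v, hv⟩ huv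
    rw [decide_eq_decide]
    rcases rel_or_rel_of_Qk_adj huv with h | h
    · exact hrel u v h hu hv
    · exact (hrel v u h hv hu).symm
  · rintro ⟨⟨i, j⟩, hu⟩ ⟨⟨i', j'⟩, hv⟩ huv
    rw [decide_eq_decide] at huv
    have key : ∃ t : Fin 4, (t = 0 ∨ t = 2) ∧ j = r i + t ∧ j' = r i' + t := by
      rcases hu with hu | hu <;> rcases hv with hv | hv <;> simp only at hu hv huv
      · exact ⟨0, Or.inl rfl, by simpa using hu, by simpa using hv⟩
      · exact ⟨0, Or.inl rfl, by simpa using hu, by simpa using huv.1 hu⟩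
      · exact ⟨0, Or.inl rfl, by simpa using huv.2 hv, by simpa using hv⟩
      · exact ⟨2, Or.inr rfl, hu, hv⟩
    obtain ⟨t, ht, rfl, rfl⟩ := key
    obtain ⟨_, _, h⟩ := (antipodal_reach hr ht i).trans (antipodal_reach hr ht i').symm
    exact h

/-- The path of antipodal positions through the layers, starting at `t`. -/
def antipodalTrack (s : ℕ → Bool) (t : Fin 4) (i : ℕ) : Fin 4 :=
  if evenLayer i then layerPos s i + t else layerPos s i + 2 + t

lemma antipodalTrack_succ (s : ℕ → Bool) (t : Fin 4) (i : ℕ) :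
    antipodalTrack s t (i + 1) = antipodalTrack s t i ∨
      antipodalTrack s t (i + 1) = antipodalTrack s t i + 1 := by
  have := layerPos_succ s i
  simp only [antipodalTrack, evenLayer_succ]
  revert this
  generalize layerPos s i = p
  generalize layerPos s (i + 1) = q
  generalize evenLayer i = b
  revert b p q t; decide

lemma posParity_antipodalTrack {s : ℕ → Bool} (h0 : s 0 = false) (t : Fin 4) (i : ℕ) :
    posParity (antipodalTrack s t i) = (s i ^^ posParity t) := by
  rw [← posParity_layerPos h0, antipodalTrack]
  generalize layerPos s i = p
  generalize evenLayer i = b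
  revert b p t; decide

lemma kempeCount_antipodal {k : ℕ} {s : ℕ → Bool} (h0 : s 0 = false)
    {f : Fin (k + 2) × Fin 4 → Fin 4} {a b t : Fin 4}
    (hf : {v | f v = a ∨ f v = b} = antipodalSet k (antipodalTrack s t)) :
    kempeCount (Qk k) f a b = if posParity t && !(s (k + 1)) then 2 else 1 := by
  rw [kempeCount, hf]
  split_ifs with h
  · simp only [Bool.and_eq_true, Bool.not_eq_true'] at h
    apply antipodal_count_eq_two (antipodalTrack_succ s t) <;>
      simp [posParity_antipodalTrack h0, h, h0]
  · apply antipodal_count_eq_one (antipodalTrack_succ s t)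
    rw [posParity_antipodalTrack h0, posParity_antipodalTrack h0, h0]
    revert h
    generalize posParity t = x
    generalize s (k + 1) = y
    revert x y; decide

lemma kempeCount_rainbow_consecutive (k : ℕ) (s : ℕ → Bool) (c : Fin 4) :
    kempeCount (Qk k) (rainbow k s) c (c + 1) = 1 := by
  rw [kempeCount]
  apply card_component_eq_one_of_layers (fun i => layerPos s i + c)
  · intro i; simp [rainbow]
  · intro i j
    simp only [rainbow, Set.mem_ofPred_eq]
    generalize layerPos s i = p
    revert p c j; decide
  · intro i
    have := layerPos_succ s i
    simp only [rainbow, Set.mem_ofPred_eq, Fin.val_castSucc, Fin.val_succ]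
    revert this
    generalize layerPos s i = p
    generalize layerPos s (i + 1) = q
    revert p q c; decide

lemma kempeCount_rainbow_opposite {k : ℕ} {s : ℕ → Bool} (h0 : s 0 = false) {c : Fin 4}
    (hc : c = 0 ∨ c = 1) : kempeCount (Qk k) (rainbow k s) c (c + 2) =
      if posParity c && !(s (k + 1)) then 2 else 1 := by
  apply kempeCount_antipodal h0
  ext ⟨i, j⟩
  simp only [rainbow, antipodalSet, antipodalTrack, Set.mem_ofPred_eq]
  generalize layerPos s i = p
  generalize evenLayer i = b
  revert b p c j; decide

lemma kempeCount_pinched_consecutive (k : ℕ) (s : ℕ → Bool) (c : Fin 4) :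
    kempeCount (Qk k) (pinched k s) c (c + 1) = 1 := by
  rw [kempeCount]
  apply card_component_eq_one_of_layers
    (fun i => layerPos s i + if c = 0 ∨ c = 3 then 0 else 2)
  · intro i
    simp only [pinched, Set.mem_ofPred_eq]
    generalize layerPos s i = p
    generalize evenLayer i = b
    revert b p c; decide
  · intro i j
    simp only [pinched, Set.mem_ofPred_eq]
    generalize layerPos s i = p
    generalize evenLayer i = b
    revert b p c j; decide
  · intro i
    have := layerPos_succ s i
    simp only [pinched, Set.mem_ofPred_eq, Fin.val_castSucc, Fin.val_succ, evenLayer_succ]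
    revert this
    generalize layerPos s i = p
    generalize layerPos s (i + 1) = q
    generalize evenLayer i = b
    revert b p q c; decide +kernel

lemma kempeCount_pinched_opposite {k : ℕ} {s : ℕ → Bool} (h0 : s 0 = false) {c : Fin 4}
    (hc : c = 0 ∨ c = 1) : kempeCount (Qk k) (pinched k s) c (c + 2) =
      if posParity c && !(s (k + 1)) then 2 else 1 := by
  apply kempeCount_antipodal h0
  ext ⟨i, j⟩
  simp only [pinched, antipodalSet, antipodalTrack, Set.mem_ofPred_eq]
  generalize layerPos s i = p
  generalize evenLayer i = b
  revert b p c j; decide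

lemma kempeTotal_rainbow {k : ℕ} {s : ℕ → Bool} (h0 : s 0 = false) :
    kempeTotal (Qk k) (rainbow k s) = if s (k + 1) then 6 else 7 := by
  have h := kempeCount_rainbow_consecutive k s
  have h02 := kempeCount_rainbow_opposite (k := k) h0 (Or.inl rfl)
  have h13 := kempeCount_rainbow_opposite (k := k) h0 (Or.inr rfl)
  have e0 := h 0
  have e1 := h 1
  have e2 := h 2
  have e3 := h 3
  simp only [Fin.reduceAdd] at e0 e1 e2 e3 h02 h13
  rw [kempeTotal, e0, e1, e2, e3, h02, h13]
  cases s (k + 1) <;> rfl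

lemma kempeTotal_pinched {k : ℕ} {s : ℕ → Bool} (h0 : s 0 = false) (hk : s (k + 1) = false) :
    kempeTotal (Qk k) (pinched k s) = 7 := by
  have h := kempeCount_pinched_consecutive k s
  have h02 := kempeCount_pinched_opposite (k := k) h0 (Or.inl rfl)
  have h13 := kempeCount_pinched_opposite (k := k) h0 (Or.inr rfl)
  have e0 := h 0
  have e1 := h 1
  have e2 := h 2
  have e3 := h 3
  simp only [Fin.reduceAdd] at e0 e1 e2 e3 h02 h13
  rw [kempeTotal, e0, e1, e2, e3, h02, h13, hk]
  rfl

/-! ### Standard colorings sharing a color class -/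

lemma rainbow_congr {k : ℕ} {s t : ℕ → Bool} (h : ∀ i ≤ k + 1, s i = t i) :
    rainbow k s = rainbow k t := by
  funext ⟨i, j⟩
  rw [rainbow, rainbow, layerPos_congr fun n hn => h n (by omega)]

lemma pinched_congr {k : ℕ} {s t : ℕ → Bool} (h : ∀ i ≤ k + 1, s i = t i) :
    pinched k s = pinched k t := by
  funext ⟨i, j⟩
  rw [pinched, pinched, layerPos_congr fun n hn => h n (by omega)]

lemma parity_eq_of_layerPos_eq {k : ℕ} {s t : ℕ → Bool} (hs : s 0 = false) (ht : t 0 = false)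
    (h : ∀ i : Fin (k + 2), layerPos s i = layerPos t i) : ∀ i ≤ k + 1, s i = t i := by
  intro i hi
  rw [← posParity_layerPos hs, ← posParity_layerPos ht]
  exact congrArg posParity (h ⟨i, by omega⟩)

lemma rainbow_share {k : ℕ} {s t : ℕ → Bool} (hs : s 0 = false) (ht : t 0 = false)
    {A : Set (Fin (k + 2) × Fin 4)} (h : A ∈ colPart (rainbow k s))
    (h' : A ∈ colPart (rainbow k t)) : ∀ i ≤ k + 1, s i = t i := by
  obtain ⟨-, c, hc⟩ := h
  obtain ⟨-, c', hc'⟩ := h'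
  have key : ∀ i : Fin (k + 2), layerPos s i + c = layerPos t i + c' := by
    intro i
    have : (i, layerPos s i + c) ∈ rainbow k t ⁻¹' {c'} := by
      rw [← hc', hc]; simp [rainbow]
    rw [add_comm _ c', ← sub_eq_iff_eq_add]
    exact this
  have hcc : c = c' := by simpa [layerPos] using key 0
  subst hcc
  exact parity_eq_of_layerPos_eq hs ht fun i => add_right_cancel (key i)

lemma rainbow_pinched_share {k : ℕ} {s t : ℕ → Bool} (hs : s 0 = false) (ht : t 0 = false)
    {A : Set (Fin (k + 2) × Fin 4)} (h : A ∈ colPart (rainbow k s))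
    (h' : A ∈ colPart (pinched k t)) : ∀ i ≤ k + 1, s i = t i := by
  obtain ⟨-, c, hc⟩ := h
  obtain ⟨-, c', hc'⟩ := h'
  have key : ∀ (i : Fin (k + 2)) j, pinchLayer (evenLayer i) (layerPos t i) j = c' ↔
      j - layerPos s i = c := by
    intro i j
    exact Set.ext_iff.1 (hc'.symm.trans hc) (i, j)
  have antipode_eq : ∀ (b : Bool) (p q c c' : Fin 4), (c' = 0 ∨ c' = 2) →
      (∀ j, pinchLayer b p j = c' ↔ j - q = c) → p + c' = q + c := by decide +kernel
  have single : ∀ (b : Bool) (p q c c' : Fin 4),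
      (∀ j, pinchLayer b p j = c' ↔ j - q = c) → c' ≠ if b then 1 else 3 := by decide +kernel
  have h1 : c' ≠ 1 := single true _ _ c c' (key 0)
  have h3 : c' ≠ 3 := by
    have hone : ((1 : Fin (k + 2)) : ℕ) = 1 := by simp
    have k1 := key 1
    rw [hone] at k1
    exact single false _ _ c c' k1
  have hc02 : c' = 0 ∨ c' = 2 := by
    clear hc' key
    revert c'; decide
  have e : ∀ i : Fin (k + 2), layerPos t i + c' = layerPos s i + c :=
    fun i => antipode_eq _ _ _ _ _ hc02 (key i)
  have hcc : c' = c := by simpa [layerPos] using e 0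
  subst hcc
  exact parity_eq_of_layerPos_eq hs ht fun i => (add_right_cancel (e i)).symm

lemma colPart_rainbow_ne_pinched {k : ℕ} (s t : ℕ → Bool) :
    colPart (rainbow k s) ≠ colPart (pinched k t) := by
  intro h
  have := Set.ext_iff.1 (preimage_eq_of_colPart_eq h (0, 1)) (0, 3)
  revert this
  simp only [Set.mem_preimage, Set.mem_singleton_iff, rainbow, pinched, layerPos, Fin.val_zero]
  decide

lemma colPart_pinched_inj {k : ℕ} {s t : ℕ → Bool} (hs : s 0 = false) (ht : t 0 = false)
    (h : colPart (pinched k s) = colPart (pinched k t)) : ∀ i ≤ k + 1, s i = t i := by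
  refine parity_eq_of_layerPos_eq hs ht fun i => ?_
  have := Set.ext_iff.1 (preimage_eq_of_colPart_eq h (0, 0)) (i, layerPos s i)
  have e : ∀ s : ℕ → Bool, pinched k s (0, 0) = 0 := fun s => rfl
  simp only [Set.mem_preimage, Set.mem_singleton_iff, e] at this
  simp only [pinched] at this
  revert this
  generalize layerPos s i = p
  generalize layerPos t i = q
  generalize evenLayer i = b
  revert b p q; decide

lemma rainbow_isolated {k : ℕ} {s : ℕ → Bool} (h0 : s 0 = false) (hk : s (k + 1) = true)
    (f : Fin (k + 2) × Fin 4 → Fin 4) (hf : IsProperColoring (Qk k) f)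
    (A : Set (Fin (k + 2) × Fin 4)) (hA : A ∈ colPart f) (hA' : A ∈ colPart (rainbow k s)) :
    colPart f = colPart (rainbow k s) := by
  obtain ⟨g, hg, hfg⟩ := hf.exists_standard
  rw [hfg] at hA ⊢
  cases hg with
  | rainbow t ht => rw [rainbow_congr (rainbow_share ht h0 hA hA')]
  | pinched t ht htk =>
    have := rainbow_pinched_share h0 ht hA' hA (k + 1) le_rfl
    rw [hk, htk] at this
    cases this

/-! ### Components of the coloring complex of `Q_k` -/

/-- The component of the color classes of `f`. -/
def coloringComponent {k : ℕ} {f : Fin (k + 2) × Fin 4 → Fin 4}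
    (hf : IsProperColoring (Qk k) f) : (colorComplex (Qk k)).ConnectedComponent :=
  (colorComplex (Qk k)).connectedComponentMk
    ⟨_, hf.mem_colorClasses (preimage_mem_colPart f (0, 0))⟩

lemma component_eq_coloringComponent {k : ℕ} {f : Fin (k + 2) × Fin 4 → Fin 4}
    (hf : IsProperColoring (Qk k) f) {A : colorClasses (Qk k)}
    (hA : (A : Set (Fin (k + 2) × Fin 4)) ∈ colPart f) :
    (colorComplex (Qk k)).connectedComponentMk A = coloringComponent hf :=
  component_eq_of_mem_colPart hf hA (preimage_mem_colPart f (0, 0))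

lemma coloringComponent_eq_of_share {k : ℕ} {f g : Fin (k + 2) × Fin 4 → Fin 4}
    (hf : IsProperColoring (Qk k) f) (hg : IsProperColoring (Qk k) g)
    {v : Fin (k + 2) × Fin 4} (h : f ⁻¹' {f v} = g ⁻¹' {g v}) :
    coloringComponent hf = coloringComponent hg := by
  have hv := preimage_mem_colPart f v
  rw [← component_eq_coloringComponent hf (A := ⟨_, hf.mem_colorClasses hv⟩) hv]
  refine component_eq_coloringComponent hg ?_
  change f ⁻¹' {f v} ∈ colPart g
  rw [h]
  exact preimage_mem_colPart g v

lemma coloringComponent_rainbow_eq_pinched {k : ℕ} {s : ℕ → Bool} (h0 : s 0 = false)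
    (hk : s (k + 1) = false) :
    coloringComponent (rainbow_isProper k s) = coloringComponent (pinched_isProper h0 hk) := by
  apply coloringComponent_eq_of_share (v := (0, 0))
  ext ⟨i, j⟩
  have e : pinched k s (0, 0) = 0 := rfl
  have e' : rainbow k s (0, 0) = 0 := by simp [rainbow, layerPos]
  simp only [Set.mem_preimage, Set.mem_singleton_iff, e, e']
  simp only [pinched, rainbow]
  generalize layerPos s i = p
  generalize evenLayer i = b
  revert b p j; decide

lemma coloringComponent_pinched_eq_of_agree {k : ℕ} {s t : ℕ → Bool} (hs : s 0 = false)
    (hsk : s (k + 1) = false) (ht : t 0 = false) (htk : t (k + 1) = false) {n : Fin (k + 2)}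
    (h : ∀ i : ℕ, evenLayer i = evenLayer n → s i = t i) :
    coloringComponent (pinched_isProper hs hsk) = coloringComponent (pinched_isProper ht htk) := by
  apply coloringComponent_eq_of_share (v := (n, layerPos s n + 1))
  ext ⟨i, j⟩
  have hi := h i
  have hn := h n rfl
  simp only [Set.mem_preimage, Set.mem_singleton_iff, pinched]
  rw [← posParity_layerPos hs, ← posParity_layerPos ht] at hi hn
  revert hi hn
  generalize layerPos s i = p
  generalize layerPos t i = p'
  generalize layerPos s n = q
  generalize layerPos t n = q'
  generalize evenLayer i = b
  generalize evenLayer n = c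
  revert b c p p' q q' j; decide +kernel

lemma coloringComponent_pinched_eq {k : ℕ} {s t : ℕ → Bool} (hs : s 0 = false)
    (hsk : s (k + 1) = false) (ht : t 0 = false) (htk : t (k + 1) = false) :
    coloringComponent (pinched_isProper hs hsk) = coloringComponent (pinched_isProper ht htk) := by
  have hone : evenLayer (1 : Fin (k + 2)) = false := by simp [evenLayer]
  have hzero : evenLayer (0 : Fin (k + 2)) = true := rfl
  let u : ℕ → Bool := fun i => if evenLayer i then s i else t i
  have hu : u 0 = false := by simp [u, hs, ht]
  have huk : u (k + 1) = false := by simp [u, hsk, htk]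
  rw [coloringComponent_pinched_eq_of_agree hs hsk hu huk (n := 0)
      fun i hi => by simp [u, hi.trans hzero],
    coloringComponent_pinched_eq_of_agree hu huk ht htk (n := 1)
      fun i hi => by simp [u, hi.trans hone]]

/-- The parity sequence with given interior values and last value. -/
def paritySeq (k : ℕ) (t : Fin k → Bool) (b : Bool) (i : ℕ) : Bool :=
  if i = k + 1 then b else if h : 1 ≤ i ∧ i ≤ k then t ⟨i - 1, by omega⟩ else false

@[simp] lemma paritySeq_zero {k : ℕ} (t : Fin k → Bool) (b : Bool) : paritySeq k t b 0 = false := by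
  simp [paritySeq]

@[simp] lemma paritySeq_last {k : ℕ} (t : Fin k → Bool) (b : Bool) :
    paritySeq k t b (k + 1) = b := by
  simp [paritySeq]

lemma paritySeq_succ {k : ℕ} (t : Fin k → Bool) (b : Bool) (i : Fin k) :
    paritySeq k t b (i + 1) = t i := by
  have h1 : (i : ℕ) ≠ k := i.2.ne
  have h2 : (i : ℕ) + 1 ≤ k := i.2
  simp [paritySeq, h1, h2]

lemma paritySeq_inj {k : ℕ} {t t' : Fin k → Bool} {b b' : Bool}
    (h : ∀ i ≤ k + 1, paritySeq k t b i = paritySeq k t' b' i) : t = t' := by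
  funext i
  rw [← paritySeq_succ t b, ← paritySeq_succ t' b', h _ (by omega)]

lemma exists_paritySeq {k : ℕ} {s : ℕ → Bool} (h0 : s 0 = false) :
    ∃ t : Fin k → Bool, ∀ i ≤ k + 1, s i = paritySeq k t (s (k + 1)) i := by
  refine ⟨fun i => s (i + 1), fun i hi => ?_⟩
  rcases Nat.eq_zero_or_pos i with rfl | hpos
  · simp [h0]
  · rcases hi.eq_or_lt with rfl | hlt
    · simp
    · obtain ⟨n, rfl⟩ : ∃ n, i = n + 1 := ⟨i - 1, by omega⟩
      exact (paritySeq_succ (fun i : Fin k => s (i + 1)) _ ⟨n, by omega⟩).symm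

/-- The standard colorings in the large component. -/
def linkedColoring (k : ℕ) (x : (Fin k → Bool) × Bool) : Fin (k + 2) × Fin 4 → Fin 4 :=
  if x.2 then rainbow k (paritySeq k x.1 false) else pinched k (paritySeq k x.1 false)

/-- The standard colorings forming components on their own. -/
def isolatedColoring (k : ℕ) (t : Fin k → Bool) : Fin (k + 2) × Fin 4 → Fin 4 :=
  rainbow k (paritySeq k t true)

lemma linkedColoring_isProper {k : ℕ} (x : (Fin k → Bool) × Bool) :
    IsProperColoring (Qk k) (linkedColoring k x) := by
  rcases x with ⟨t, _ | _⟩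
  · exact pinched_isProper (by simp) (by simp)
  · exact rainbow_isProper _ _

lemma isolatedColoring_isProper {k : ℕ} (t : Fin k → Bool) :
    IsProperColoring (Qk k) (isolatedColoring k t) := rainbow_isProper _ _

lemma isolatedColoring_isolated {k : ℕ} (t : Fin k → Bool)
    (f : Fin (k + 2) × Fin 4 → Fin 4) (hf : IsProperColoring (Qk k) f)
    (A : Set (Fin (k + 2) × Fin 4)) (hA : A ∈ colPart f)
    (hA' : A ∈ colPart (isolatedColoring k t)) : colPart f = colPart (isolatedColoring k t) :=
  rainbow_isolated (by simp) (by simp) f hf A hA hA'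

lemma exists_linked_or_isolated {k : ℕ} {f : Fin (k + 2) × Fin 4 → Fin 4}
    (hf : IsProperColoring (Qk k) f) :
    (∃ x, colPart f = colPart (linkedColoring k x)) ∨
      ∃ t, colPart f = colPart (isolatedColoring k t) := by
  obtain ⟨g, hg, hfg⟩ := hf.exists_standard
  rw [hfg]
  cases hg with
  | rainbow s h0 =>
    obtain ⟨t, ht⟩ := exists_paritySeq (k := k) h0
    cases hk : s (k + 1) <;> rw [hk] at ht
    · exact Or.inl ⟨(t, true), by rw [rainbow_congr ht]; rfl⟩
    · exact Or.inr ⟨t, by rw [rainbow_congr ht]; rfl⟩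
  | pinched s h0 hk =>
    obtain ⟨t, ht⟩ := exists_paritySeq (k := k) h0
    rw [hk] at ht
    exact Or.inl ⟨(t, false), by rw [pinched_congr ht]; rfl⟩

lemma colPart_linkedColoring_injective (k : ℕ) :
    Function.Injective fun x => colPart (linkedColoring k x) := by
  rintro ⟨t, b⟩ ⟨t', b'⟩ h
  rcases b with _ | _ <;> rcases b' with _ | _
  · exact congrArg (·, false) (paritySeq_inj (colPart_pinched_inj (by simp) (by simp) h))
  · exact absurd h.symm (colPart_rainbow_ne_pinched _ _)
  · exact absurd h (colPart_rainbow_ne_pinched _ _)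
  · have hA := preimage_mem_colPart (linkedColoring k (t, true)) (0, 0)
    have hA' := hA
    rw [show colPart (linkedColoring k (t, true)) = colPart (linkedColoring k (t', true))
      from h] at hA'
    exact congrArg (·, true) (paritySeq_inj (rainbow_share (by simp) (by simp) hA hA'))

lemma linkedColoring_not_share_isolated {k : ℕ} (x : (Fin k → Bool) × Bool) (t : Fin k → Bool)
    (A : Set (Fin (k + 2) × Fin 4)) (hA : A ∈ colPart (linkedColoring k x)) :
    A ∉ colPart (isolatedColoring k t) := by
  intro hA'
  rcases x with ⟨t', _ | _⟩
  · simpa using rainbow_pinched_share (by simp) (by simp) hA' hA (k + 1) le_rfl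
  · simpa using rainbow_share (by simp) (by simp) hA' hA (k + 1) le_rfl

lemma coloringComponent_linked_eq {k : ℕ} (x y : (Fin k → Bool) × Bool) :
    coloringComponent (linkedColoring_isProper x) =
      coloringComponent (linkedColoring_isProper y) := by
  have key : ∀ x : (Fin k → Bool) × Bool, coloringComponent (linkedColoring_isProper x) =
      coloringComponent (linkedColoring_isProper (k := k) (fun _ => false, false)) := by
    rintro ⟨t, _ | _⟩
    · exact coloringComponent_pinched_eq (by simp) (by simp) (by simp) (by simp)
    · exact (coloringComponent_rainbow_eq_pinched (by simp) (by simp)).trans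
        (coloringComponent_pinched_eq (by simp) (by simp) (by simp) (by simp))
  rw [key x, key y]

lemma component_eq_isolated_iff {k : ℕ} (t : Fin k → Bool) (A : colorClasses (Qk k)) :
    (colorComplex (Qk k)).connectedComponentMk A =
        coloringComponent (isolatedColoring_isProper t) ↔
      (A : Set (Fin (k + 2) × Fin 4)) ∈ colPart (isolatedColoring k t) :=
  component_eq_iff_of_isolated (isolatedColoring_isProper t) (isolatedColoring_isolated t)
    (preimage_mem_colPart _ _)

lemma coloringComponent_linked_ne_isolated {k : ℕ} (x : (Fin k → Bool) × Bool)
    (t : Fin k → Bool) : coloringComponent (linkedColoring_isProper x) ≠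
      coloringComponent (isolatedColoring_isProper t) := fun h =>
  linkedColoring_not_share_isolated x t _ (preimage_mem_colPart _ _)
    ((component_eq_isolated_iff t _).1 h)

lemma coloringComponent_isolated_injective (k : ℕ) :
    Function.Injective fun t : Fin k → Bool =>
      coloringComponent (isolatedColoring_isProper t) := by
  intro t t' h
  exact paritySeq_inj (rainbow_share (by simp) (by simp) (preimage_mem_colPart _ (0, 0))
    ((component_eq_isolated_iff t' _).1 h))

lemma component_eq_linked_or_isolated {k : ℕ} (x : (Fin k → Bool) × Bool)
    (K : (colorComplex (Qk k)).ConnectedComponent) :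
    K = coloringComponent (linkedColoring_isProper x) ∨
      ∃ t, coloringComponent (isolatedColoring_isProper t) = K := by
  induction K using SimpleGraph.ConnectedComponent.ind with
  | h A =>
    obtain ⟨f, hf, hA⟩ := exists_coloring_of_class A
    rcases exists_linked_or_isolated hf with ⟨y, hy⟩ | ⟨t, ht⟩
    · left
      rw [component_eq_coloringComponent (linkedColoring_isProper y) (hy ▸ hA),
        coloringComponent_linked_eq y x]
    · right
      exact ⟨t, ((component_eq_isolated_iff t A).2 (ht ▸ hA)).symm⟩

lemma meetsQk_linked {k : ℕ} (x : (Fin k → Bool) × Bool) :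
    meetsQk k (coloringComponent (linkedColoring_isProper x)) =
      Set.range fun y => colPart (linkedColoring k y) := by
  ext P
  constructor
  · rintro ⟨⟨f, hf, rfl⟩, A, hAK, hA⟩
    rcases exists_linked_or_isolated hf with ⟨y, hy⟩ | ⟨t, ht⟩
    · exact ⟨y, hy.symm⟩
    · rw [ht] at hA
      exact absurd (hAK.symm.trans ((component_eq_isolated_iff t A).2 hA))
        (coloringComponent_linked_ne_isolated x t)
  · rintro ⟨y, rfl⟩
    exact ⟨⟨_, linkedColoring_isProper y, rfl⟩,
      ⟨_, (linkedColoring_isProper y).mem_colorClasses (preimage_mem_colPart _ (0, 0))⟩,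
      coloringComponent_linked_eq y x, preimage_mem_colPart _ _⟩

lemma meetsQk_isolated_subset {k : ℕ} (t : Fin k → Bool) :
    meetsQk k (coloringComponent (isolatedColoring_isProper t)) ⊆
      {colPart (isolatedColoring k t)} := by
  rintro P ⟨⟨f, hf, rfl⟩, A, hAK, hA⟩
  exact isolatedColoring_isolated t f hf A hA ((component_eq_isolated_iff t A).1 hAK)

lemma ncard_colPart {V : Type*} {f : V → Fin 4} (hf : Function.Surjective f) :
    (colPart f).ncard = 4 := by
  have h : colPart f = Set.range fun c => f ⁻¹' {c} := by
    ext A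
    constructor
    · rintro ⟨-, c, rfl⟩
      exact ⟨c, rfl⟩
    · rintro ⟨c, rfl⟩
      exact ⟨hf c, c, rfl⟩
  have hinj : Function.Injective fun c => f ⁻¹' {c} :=
    hf.preimage_injective.comp Set.singleton_injective
  rw [h, ← Set.image_univ, Set.ncard_image_of_injective _ hinj, Set.ncard_univ]
  simp

lemma oddPartition_linkedColoring {k : ℕ} (x : (Fin k → Bool) × Bool) :
    OddPartition (Qk k) (colPart (linkedColoring k x)) := by
  rcases x with ⟨t, _ | _⟩
  · apply oddPartition_of_kempeTotal (pinched_surjective _ _)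
    rw [kempeTotal_pinched (by simp) (by simp)]
    decide
  · apply oddPartition_of_kempeTotal (rainbow_surjective _ _)
    rw [kempeTotal_rainbow (by simp), paritySeq_last]
    decide

lemma evenPartition_isolatedColoring {k : ℕ} (t : Fin k → Bool) :
    EvenPartition (Qk k) (colPart (isolatedColoring k t)) := by
  apply evenPartition_of_kempeTotal (rainbow_surjective _ _)
  rw [kempeTotal_rainbow (by simp), paritySeq_last]
  decide

/-- `B(Q_k)` has exactly one connected component meeting more than one
coloring-partition; that component meets exactly `2^(k+1)` coloring-partitions, all odd;
each remaining component (there are `2^k` of them) consists precisely of the four color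
classes of a single even coloring-partition. -/
theorem colorComplex_Qk_structure (k : ℕ) :
    ∃ K : (colorComplex (Qk k)).ConnectedComponent,
      1 < (meetsQk k K).ncard ∧
      (∀ K', 1 < (meetsQk k K').ncard → K' = K) ∧
      (meetsQk k K).ncard = 2 ^ (k + 1) ∧
      (∀ P ∈ meetsQk k K, OddPartition (Qk k) P) ∧
      {K' : (colorComplex (Qk k)).ConnectedComponent | K' ≠ K}.ncard = 2 ^ k ∧
      (∀ K', K' ≠ K →
        ∃ P, IsColoringPartition (Qk k) P ∧ EvenPartition (Qk k) P ∧ P.ncard = 4 ∧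
          Subtype.val '' {A : colorClasses (Qk k) |
            (colorComplex (Qk k)).connectedComponentMk A = K'} = P) := by
  have hcard : (meetsQk k (coloringComponent
      (linkedColoring_isProper (k := k) (fun _ => false, false)))).ncard = 2 ^ (k + 1) := by
    rw [meetsQk_linked, ← Set.image_univ,
      Set.ncard_image_of_injective _ (colPart_linkedColoring_injective k), Set.ncard_univ]
    simp [pow_succ]
  refine ⟨coloringComponent (linkedColoring_isProper (fun _ => false, false)), ?_, ?_, hcard,
    ?_, ?_, ?_⟩
  · rw [hcard]
    exact Nat.one_lt_two_pow (by omega)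
  · intro K' hK'
    rcases component_eq_linked_or_isolated (fun _ => false, false) K' with h | ⟨t, rfl⟩
    · exact h
    · have := Set.ncard_le_ncard (meetsQk_isolated_subset t) (Set.finite_singleton _)
      rw [Set.ncard_singleton] at this
      omega
  · rw [meetsQk_linked]
    rintro _ ⟨x, rfl⟩
    exact oddPartition_linkedColoring x
  · have : {K' | K' ≠ coloringComponent
        (linkedColoring_isProper (k := k) (fun _ => false, false))} =
        Set.range fun t => coloringComponent (isolatedColoring_isProper t) := by
      ext K'
      constructor
      · exact (component_eq_linked_or_isolated _ K').resolve_left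
      · rintro ⟨t, rfl⟩
        exact (coloringComponent_linked_ne_isolated _ t).symm
    rw [this, ← Set.image_univ,
      Set.ncard_image_of_injective _ (coloringComponent_isolated_injective k), Set.ncard_univ]
    simp
  · intro K' hK'
    obtain ⟨t, rfl⟩ := (component_eq_linked_or_isolated _ K').resolve_left hK'
    refine ⟨colPart (isolatedColoring k t), ⟨_, isolatedColoring_isProper t, rfl⟩,
      evenPartition_isolatedColoring t, ncard_colPart (rainbow_surjective _ _), ?_⟩
    ext A
    simp only [component_eq_isolated_iff, Set.mem_image, Set.mem_ofPred_eq]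
    constructor
    · rintro ⟨B, hB, rfl⟩
      exact hB
    · intro hA
      exact ⟨⟨A, (isolatedColoring_isProper t).mem_colorClasses hA⟩, hA, rfl⟩
end

section
/- The 12-vertex graph Q_1 has exactly 144 proper 4-colorings f : V(Q_1) → Fin 4; equivalently, Q_1 has exactly 6 coloring-partitions. -/
instance (k : ℕ) : DecidableRel (qkRel k) := fun _ _ => by
  unfold qkRel
  infer_instance

namespace Q1Coloring

/-- The proper 4-colorings of `Q_1` that give `a_0`, `b_0`, `c_0` the colors `0`, `1`, `2`,
as matrices whose `i`-th row lists the colors of `a_i`, `b_i`, `c_i`, `d_i`. -/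
def normalRows : Fin 6 → Fin 3 → Fin 4 → Fin 4 :=
  ![![![0, 1, 2, 1], ![2, 3, 0, 3], ![0, 1, 2, 1]],
    ![![0, 1, 2, 1], ![3, 2, 3, 0], ![2, 1, 0, 1]],
    ![![0, 1, 2, 3], ![1, 2, 3, 0], ![2, 3, 0, 1]],
    ![![0, 1, 2, 3], ![1, 2, 3, 0], ![3, 0, 1, 2]],
    ![![0, 1, 2, 3], ![2, 3, 0, 1], ![0, 1, 2, 3]],
    ![![0, 1, 2, 3], ![2, 3, 0, 1], ![3, 0, 1, 2]]]

def normalColoring (i : Fin 6) (v : Fin (1 + 2) × Fin 4) : Fin 4 := normalRows i v.1 v.2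

theorem isProperColoring_Qk_iff {k : ℕ} {f : Fin (k + 2) × Fin 4 → Fin 4} :
    IsProperColoring (Qk k) f ↔ ∀ u v, u ≠ v → qkRel k u v → f u ≠ f v := by
  simp only [IsProperColoring, Qk, SimpleGraph.fromRel_adj]
  refine ⟨fun h u v huv hr => h ⟨huv, .inl hr⟩, ?_⟩
  rintro h u v ⟨huv, hr | hr⟩
  · exact h u v huv hr
  · exact (h v u huv.symm hr).symm

theorem isProperColoring_normalColoring (i : Fin 6) :
    IsProperColoring (Qk 1) (normalColoring i) := by
  rw [isProperColoring_Qk_iff]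
  revert i
  decide +kernel

theorem IsProperColoring.perm_comp {V : Type*} {G : SimpleGraph V} {f : V → Fin 4}
    (hf : IsProperColoring G f) (σ : Equiv.Perm (Fin 4)) : IsProperColoring G (σ ∘ f) :=
  fun _ _ huv h => hf huv (σ.injective h)

set_option synthInstance.maxSize 1000 in
theorem exists_normalRows_eq :
    ∀ d₀ : Fin 4, d₀ ≠ 0 → d₀ ≠ 2 →
    ∀ a₁ : Fin 4, a₁ ≠ 0 → a₁ ≠ d₀ →
    ∀ b₁ : Fin 4, b₁ ≠ 1 → b₁ ≠ 0 → b₁ ≠ a₁ →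
    ∀ c₁ : Fin 4, c₁ ≠ 2 → c₁ ≠ 1 → c₁ ≠ b₁ →
    ∀ d₁ : Fin 4, d₁ ≠ d₀ → d₁ ≠ 2 → d₁ ≠ c₁ → d₁ ≠ a₁ →
    ∀ a₂ : Fin 4, a₂ ≠ a₁ → a₂ ≠ d₁ →
    ∀ b₂ : Fin 4, b₂ ≠ b₁ → b₂ ≠ a₁ → b₂ ≠ a₂ →
    ∀ c₂ : Fin 4, c₂ ≠ c₁ → c₂ ≠ b₁ → c₂ ≠ b₂ → c₂ ≠ a₂ →
    ∀ d₂ : Fin 4, d₂ ≠ d₁ → d₂ ≠ c₁ → d₂ ≠ c₂ → d₂ ≠ a₂ →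
    ∃ i, normalRows i = ![![0, 1, 2, d₀], ![a₁, b₁, c₁, d₁], ![a₂, b₂, c₂, d₂]] := by
  decide +kernel

theorem exists_eq_normalColoring {g : Fin (1 + 2) × Fin 4 → Fin 4}
    (hg : IsProperColoring (Qk 1) g) (ha : g (0, 0) = 0) (hb : g (0, 1) = 1)
    (hc : g (0, 2) = 2) : ∃ i, g = normalColoring i := by
  have ne (u v) (huv : u ≠ v ∧ (qkRel 1 u v ∨ qkRel 1 v u)) : g u ≠ g v :=
    hg ((SimpleGraph.fromRel_adj _ _ _).2 huv)
  obtain ⟨i, hi⟩ := exists_normalRows_eq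
    (g (0, 3)) (ne_of_ne_of_eq (ne _ _ (by decide)) ha) (ne_of_ne_of_eq (ne _ _ (by decide)) hc)
    (g (1, 0)) (ne_of_ne_of_eq (ne _ _ (by decide)) ha) (ne _ _ (by decide))
    (g (1, 1)) (ne_of_ne_of_eq (ne _ _ (by decide)) hb)
      (ne_of_ne_of_eq (ne _ _ (by decide)) ha) (ne _ _ (by decide))
    (g (1, 2)) (ne_of_ne_of_eq (ne _ _ (by decide)) hc)
      (ne_of_ne_of_eq (ne _ _ (by decide)) hb) (ne _ _ (by decide))
    (g (1, 3)) (ne _ _ (by decide)) (ne_of_ne_of_eq (ne _ _ (by decide)) hc) (ne _ _ (by decide))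
      (ne _ _ (by decide))
    (g (2, 0)) (ne _ _ (by decide)) (ne _ _ (by decide))
    (g (2, 1)) (ne _ _ (by decide)) (ne _ _ (by decide)) (ne _ _ (by decide))
    (g (2, 2)) (ne _ _ (by decide)) (ne _ _ (by decide)) (ne _ _ (by decide))
      (ne _ _ (by decide))
    (g (2, 3)) (ne _ _ (by decide)) (ne _ _ (by decide)) (ne _ _ (by decide))
      (ne _ _ (by decide))
  refine ⟨i, funext fun ⟨r, j⟩ => ?_⟩
  rw [normalColoring, hi]
  fin_cases r <;> fin_cases j <;> first | rfl | assumption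

theorem exists_perm_apply_eq : ∀ x y z : Fin 4, x ≠ y → x ≠ z → y ≠ z →
    ∃ σ : Equiv.Perm (Fin 4), σ 0 = x ∧ σ 1 = y ∧ σ 2 = z := by
  decide +kernel

theorem perm_eq_of_apply_eq : ∀ σ τ : Equiv.Perm (Fin 4),
    σ 0 = τ 0 → σ 1 = τ 1 → σ 2 = τ 2 → σ = τ := by
  decide +kernel

theorem exists_eq_perm_comp_normalColoring {f : Fin (1 + 2) × Fin 4 → Fin 4}
    (hf : IsProperColoring (Qk 1) f) :
    ∃ (σ : Equiv.Perm (Fin 4)) (i : Fin 6), f = σ ∘ normalColoring i := by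
  have ne (u v) (huv : u ≠ v ∧ (qkRel 1 u v ∨ qkRel 1 v u)) : f u ≠ f v :=
    hf ((SimpleGraph.fromRel_adj _ _ _).2 huv)
  obtain ⟨σ, ha, hb, hc⟩ := exists_perm_apply_eq (f (0, 0)) (f (0, 1)) (f (0, 2))
    (ne _ _ (by decide)) (ne _ _ (by decide)) (ne _ _ (by decide))
  obtain ⟨i, hi⟩ := exists_eq_normalColoring (IsProperColoring.perm_comp hf σ.symm)
    (σ.symm_apply_eq.2 ha.symm) (σ.symm_apply_eq.2 hb.symm) (σ.symm_apply_eq.2 hc.symm)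
  refine ⟨σ, i, ?_⟩
  rw [← hi, ← Function.comp_assoc, Equiv.self_comp_symm, Function.id_comp]

theorem colPart_perm_comp {V : Type*} (f : V → Fin 4) (σ : Equiv.Perm (Fin 4)) :
    colPart (σ ∘ f) = colPart f := by
  ext A
  refine and_congr_right fun _ => (σ.exists_congr fun c => ?_).symm
  suffices f ⁻¹' {c} = (σ ∘ f) ⁻¹' {σ c} by rw [this]
  ext v
  simp

theorem exists_mem_colPart_iff {V : Type*} (f : V → Fin 4) (u v : V) :
    (∃ A ∈ colPart f, u ∈ A ∧ v ∈ A) ↔ f u = f v := by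
  constructor
  · rintro ⟨_, ⟨_, c, rfl⟩, hu, hv⟩
    exact hu.trans hv.symm
  · exact fun h => ⟨f ⁻¹' {f u}, ⟨⟨u, rfl⟩, f u, rfl⟩, rfl, h.symm⟩

theorem eq_of_normalColoring_eq_iff : ∀ i j : Fin 6,
    (∀ u v, normalColoring i u = normalColoring i v ↔
      normalColoring j u = normalColoring j v) → i = j := by
  decide +kernel

theorem colPart_normalColoring_injective :
    Function.Injective fun i => colPart (normalColoring i) := by
  intro i j (h : colPart (normalColoring i) = colPart (normalColoring j))
  refine eq_of_normalColoring_eq_iff i j fun u v => ?_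
  rw [← exists_mem_colPart_iff, h, exists_mem_colPart_iff]

theorem normalColoring_anchors (i : Fin 6) : normalColoring i (0, 0) = 0 ∧
    normalColoring i (0, 1) = 1 ∧ normalColoring i (0, 2) = 2 := by
  revert i
  decide

theorem bijective_perm_comp_normalColoring :
    Function.Bijective fun p : Equiv.Perm (Fin 4) × Fin 6 =>
      (⟨p.1 ∘ normalColoring p.2,
        IsProperColoring.perm_comp (isProperColoring_normalColoring p.2) p.1⟩ :
        {f : Fin (1 + 2) × Fin 4 → Fin 4 // IsProperColoring (Qk 1) f}) := by
  constructor
  · rintro ⟨σ, i⟩ ⟨τ, j⟩ h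
    have h' : σ ∘ normalColoring i = τ ∘ normalColoring j := congrArg Subtype.val h
    have hij : i = j := colPart_normalColoring_injective <| by
      simpa only [colPart_perm_comp] using congrArg colPart h'
    subst hij
    obtain ⟨ha, hb, hc⟩ := normalColoring_anchors i
    have hσ : σ = τ := perm_eq_of_apply_eq σ τ
      (by simpa [ha] using congrFun h' (0, 0)) (by simpa [hb] using congrFun h' (0, 1))
      (by simpa [hc] using congrFun h' (0, 2))
    rw [hσ]
  · rintro ⟨f, hf⟩
    obtain ⟨σ, i, rfl⟩ := exists_eq_perm_comp_normalColoring hf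
    exact ⟨(σ, i), rfl⟩

theorem setOf_isColoringPartition : {P | IsColoringPartition (Qk 1) P} =
    Set.range fun i => colPart (normalColoring i) := by
  ext P
  constructor
  · rintro ⟨f, hf, rfl⟩
    obtain ⟨σ, i, rfl⟩ := exists_eq_perm_comp_normalColoring hf
    exact ⟨i, (colPart_perm_comp _ σ).symm⟩
  · rintro ⟨i, rfl⟩
    exact ⟨_, isProperColoring_normalColoring i, rfl⟩

end Q1Coloring

open Q1Coloring in
/-- The 12-vertex graph `Q_1` has exactly 144 proper 4-colorings, equivalently exactly
6 coloring-partitions. -/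
theorem Q1_coloring_count :
    Nat.card {f : Fin (1 + 2) × Fin 4 → Fin 4 // IsProperColoring (Qk 1) f} = 144 ∧
    {P : Set (Set (Fin (1 + 2) × Fin 4)) | IsColoringPartition (Qk 1) P}.ncard = 6 := by
  constructor
  · rw [← Nat.card_eq_of_bijective _ bijective_perm_comp_normalColoring, Nat.card_prod,
      Nat.card_perm, Nat.card_fin, Nat.card_fin]
    rfl
  · rw [setOf_isColoringPartition, ← Set.image_univ,
      Set.ncard_image_of_injective _ colPart_normalColoring_injective, Set.ncard_univ,
      Nat.card_fin]
end
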